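/- (Theorem 2.10, (a) ⇒ (b), converse Lyapunov theorem with periodicity) Assume hypotheses (H1)–(H4) and that 0 ∈ C([−r,0]; ℝⁿ) is URGAS: there exists σ ∈ KL such that every maximal solution with data (t₀, x₀, d) ∈ [0,∞) × C([−r,0]; ℝⁿ) × M_D is defined on [t₀,∞) and satisfies ‖T_r(t)x‖_r ≤ σ(‖x₀‖_r, t−t₀) for all t ≥ t₀. Then there exists a continuous V : [0,∞) × C([−r,0]; ℝⁿ) → [0,∞) such that: (i) there exist a₁, a₂ ∈ K∞ with a₁(‖x‖_r) ≤ V(t,x) ≤ a₂(‖x‖_r) for all (t,x); (ii) V⁰(t, x; f(t,x,d)) ≤ −V(t,x) for all (t,x,d); (iii) there is a non-decreasing M : [0,∞) → [0,∞) with |V(t,y) − V(t,x)| ≤ M(R)‖y−x‖_r whenever t ∈ [0,R] and ‖x‖_r, ‖y‖_r ≤ R. Moreover, if f is T-periodic (f(t+T,x,d) = f(t,x,d) for all t,x,d) then V can be chosen T-periodic (V(t+T,x) = V(t,x) for all t,x), and if f is independent of t then V can be chosen independent of t. -/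

import Mathlib

open Set Filter MeasureTheory
open scoped RealInnerProductSpace

noncomputable section

/-- ℝⁿ with the Euclidean norm. -/
abbrev Euc (n : ℕ) : Type := EuclideanSpace ℝ (Fin n)

/-- The sup norm `‖y‖_q = max_{θ ∈ [-q,0]} |y θ|` of a history segment. -/
def histNorm (n : ℕ) (q : ℝ) (y : ℝ → Euc n) : ℝ :=
  sSup ((fun θ => ‖y θ‖) '' Icc (-q) 0)

/-- The class `M_D` of allowed disturbances: right-continuous maps `d : [0,∞) → D`
which are continuous outside a countable set with no finite accumulation point. -/
def MD (l : ℕ) (D : Set (Euc l)) (d : ℝ → Euc l) : Prop :=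
  (∀ t, 0 ≤ t → d t ∈ D) ∧
  (∀ t, 0 ≤ t → ∀ ε > 0, ∃ δ > 0, ∀ s, t ≤ s → s - t < δ → ‖d s - d t‖ < ε) ∧
  ∃ A : Set ℝ, (∀ C : ℝ, (A ∩ Icc 0 C).Finite) ∧
    ∀ t, 0 ≤ t → t ∉ A → ∀ ε > 0, ∃ δ > 0, ∀ s, 0 ≤ s → |s - t| < δ → ‖d s - d t‖ < ε

/-- The operator `E_h(x;v)`. -/
def Eop (n : ℕ) (x : ℝ → Euc n) (h : ℝ) (v : Euc n) : ℝ → Euc n :=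
  fun θ => if -h < θ then x 0 + (θ + h) • v else x (θ + h)

/-- The generalized (Dini-type) derivative
`V⁰(t,x;v) = limsup_{h→0⁺, y→0} (V(t+h, E_h(x;v)+h y) - V(t,x))/h` of a functional `V`
defined on `[0,∞) × C([-q,0];ℝⁿ)`, with values in the extended reals. -/
def Vdot (n : ℕ) (q : ℝ) (V : ℝ → (ℝ → Euc n) → ℝ) (t : ℝ)
    (x : ℝ → Euc n) (v : Euc n) : EReal :=
  ⨅ δ : Ioi (0:ℝ), ⨆ p : {p : ℝ × (ℝ → Euc n) //
      0 < p.1 ∧ p.1 < (δ : ℝ) ∧ ContinuousOn p.2 (Icc (-q) 0) ∧ histNorm n q p.2 < (δ : ℝ)},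
    (((V (t + p.1.1) (fun θ => Eop n x p.1.1 v θ + p.1.1 • p.1.2 θ) - V t x) / p.1.1 : ℝ) : EReal)

/-- The upper right Dini derivative `D⁺v(t) = limsup_{h→0⁺} (v(t+h)-v(t))/h`. -/
def DiniUpper (v : ℝ → ℝ) (t : ℝ) : EReal :=
  Filter.limsup (fun h => (((v (t + h) - v t) / h : ℝ) : EReal)) (nhdsWithin 0 (Ioi 0))

/-- Class `K∞` functions (on `[0,∞)`). -/
def IsKInf (a : ℝ → ℝ) : Prop :=
  ContinuousOn a (Ici 0) ∧ StrictMonoOn a (Ici 0) ∧ a 0 = 0 ∧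
  (∀ s, 0 ≤ s → 0 ≤ a s) ∧ Filter.Tendsto a Filter.atTop Filter.atTop

/-- Class `K⁺`: positive continuous functions on `[0,∞)`. -/
def IsKPlus (b : ℝ → ℝ) : Prop :=
  ContinuousOn b (Ici 0) ∧ ∀ t, 0 ≤ t → 0 < b t

/-- Class `KL` functions. -/
def IsKL (σ : ℝ → ℝ → ℝ) : Prop :=
  ContinuousOn (fun p : ℝ × ℝ => σ p.1 p.2) (Ici 0 ×ˢ Ici 0) ∧
  (∀ s t, 0 ≤ s → 0 ≤ t → 0 ≤ σ s t) ∧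
  (∀ t, 0 ≤ t → StrictMonoOn (fun s => σ s t) (Ici 0) ∧ σ 0 t = 0) ∧
  (∀ s, 0 ≤ s → AntitoneOn (σ s) (Ici 0)) ∧
  (∀ s, 0 ≤ s → Filter.Tendsto (σ s) Filter.atTop (nhds 0))

/-- Hypothesis (H1): a one-sided Lipschitz estimate. -/
def H1 (n l : ℕ) (r : ℝ) (D : Set (Euc l)) (f : ℝ → (ℝ → Euc n) → Euc l → Euc n) : Prop :=
  ∃ L : ℝ → ℝ → ℝ,
    ContinuousOn (fun p : ℝ × ℝ => L p.1 p.2) (Ici 0 ×ˢ Ici 0) ∧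
    (∀ t, 0 ≤ t → MonotoneOn (L t) (Ici 0)) ∧
    (∀ s, 0 ≤ s → MonotoneOn (fun t => L t s) (Ici 0)) ∧
    (∀ t s, 0 ≤ t → 0 ≤ s → 0 ≤ L t s) ∧
    ∀ t x y d, 0 ≤ t → ContinuousOn x (Icc (-r) 0) → ContinuousOn y (Icc (-r) 0) → d ∈ D →
      (inner ℝ (x 0 - y 0) (f t x d - f t y d) : ℝ) ≤
        L t (histNorm n r x + histNorm n r y) * (histNorm n r (x - y))^2

/-- Hypothesis (H2): `f` maps bounded sets to bounded sets, uniformly in `d ∈ D`. -/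
def H2 (n l : ℕ) (r : ℝ) (D : Set (Euc l)) (f : ℝ → (ℝ → Euc n) → Euc l → Euc n) : Prop :=
  ∀ Tb Rb : ℝ, ∃ C : ℝ, ∀ t x d, 0 ≤ t → t ≤ Tb → ContinuousOn x (Icc (-r) 0) →
    histNorm n r x ≤ Rb → d ∈ D → ‖f t x d‖ ≤ C

/-- Hypothesis (H3): continuity off a countable exceptional set of times with no finite
accumulation point, plus right-continuity in time everywhere. -/
def H3 (n l : ℕ) (r : ℝ) (D : Set (Euc l)) (f : ℝ → (ℝ → Euc n) → Euc l → Euc n) : Prop :=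
  ∃ A : Set ℝ, (∀ C : ℝ, (A ∩ Icc 0 C).Finite) ∧
    (∀ t x d, 0 ≤ t → t ∉ A → ContinuousOn x (Icc (-r) 0) → d ∈ D →
      ∀ ε > 0, ∃ δ > 0, ∀ t' x' d', 0 ≤ t' → ContinuousOn x' (Icc (-r) 0) → d' ∈ D →
        |t' - t| < δ → histNorm n r (x' - x) < δ → ‖d' - d‖ < δ →
          ‖f t' x' d' - f t x d‖ < ε) ∧
    (∀ t x d, 0 ≤ t → ContinuousOn x (Icc (-r) 0) → d ∈ D →
      ∀ ε > 0, ∃ δ > 0, ∀ t', t ≤ t' → t' - t < δ → ‖f t' x d - f t x d‖ < ε)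

/-- Hypothesis (H4). -/
def H4 (n l : ℕ) (r : ℝ) (D : Set (Euc l)) (f : ℝ → (ℝ → Euc n) → Euc l → Euc n) : Prop :=
  ∀ ε > 0, ∀ t, 0 ≤ t → ∃ δ > 0, ∀ τ x d, 0 ≤ τ → d ∈ D → ContinuousOn x (Icc (-r) 0) →
    |τ - t| + histNorm n r x < δ → ‖f τ x d‖ < ε

/-- A solution of the RFDE on `[t₀ - r, T)` (continuous, absolutely continuous on compact
subintervals of `[t₀,T)` and satisfying the equation a.e., expressed in integral form). -/
def IsSolIco (n l : ℕ) (r : ℝ) (f : ℝ → (ℝ → Euc n) → Euc l → Euc n) (d : ℝ → Euc l)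
    (t₀ T : ℝ) (x : ℝ → Euc n) : Prop :=
  ContinuousOn x (Ico (t₀ - r) T) ∧
  ∀ t ∈ Ico t₀ T,
    IntervalIntegrable (fun s => f s (fun θ => x (s + θ)) (d s)) volume t₀ t ∧
    x t = x t₀ + ∫ s in t₀..t, f s (fun θ => x (s + θ)) (d s)

/-- A solution of the RFDE on all of `[t₀ - r, ∞)`. -/
def IsSolGlobal (n l : ℕ) (r : ℝ) (f : ℝ → (ℝ → Euc n) → Euc l → Euc n) (d : ℝ → Euc l)
    (t₀ : ℝ) (x : ℝ → Euc n) : Prop :=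
  ContinuousOn x (Ici (t₀ - r)) ∧
  ∀ t, t₀ ≤ t →
    IntervalIntegrable (fun s => f s (fun θ => x (s + θ)) (d s)) volume t₀ t ∧
    x t = x t₀ + ∫ s in t₀..t, f s (fun θ => x (s + θ)) (d s)

/-- Non-uniform in time robust global asymptotic stability of `0` for the RFDE:
every maximal solution is defined on `[t₀,∞)` and satisfies the `KL` estimate (2.6). -/
def RGASnu (n l : ℕ) (r : ℝ) (D : Set (Euc l))
    (f : ℝ → (ℝ → Euc n) → Euc l → Euc n) : Prop :=
  ∃ σ : ℝ → ℝ → ℝ, ∃ β : ℝ → ℝ, IsKL σ ∧ IsKPlus β ∧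
    (∀ t₀ x₀ d, 0 ≤ t₀ → ContinuousOn x₀ (Icc (-r) 0) → MD l D d →
      ∃ x : ℝ → Euc n, IsSolGlobal n l r f d t₀ x ∧ ∀ θ ∈ Icc (-r) 0, x (t₀ + θ) = x₀ θ) ∧
    (∀ t₀ x₀ d x, 0 ≤ t₀ → ContinuousOn x₀ (Icc (-r) 0) → MD l D d →
      IsSolGlobal n l r f d t₀ x → (∀ θ ∈ Icc (-r) 0, x (t₀ + θ) = x₀ θ) →
      ∀ t, t₀ ≤ t →
        histNorm n r (fun θ => x (t + θ)) ≤ σ (β t₀ * histNorm n r x₀) (t - t₀))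

/-- Uniform robust global asymptotic stability of `0` for the RFDE. -/
def URGAS (n l : ℕ) (r : ℝ) (D : Set (Euc l))
    (f : ℝ → (ℝ → Euc n) → Euc l → Euc n) : Prop :=
  ∃ σ : ℝ → ℝ → ℝ, IsKL σ ∧
    (∀ t₀ x₀ d, 0 ≤ t₀ → ContinuousOn x₀ (Icc (-r) 0) → MD l D d →
      ∃ x : ℝ → Euc n, IsSolGlobal n l r f d t₀ x ∧ ∀ θ ∈ Icc (-r) 0, x (t₀ + θ) = x₀ θ) ∧
    (∀ t₀ x₀ d x, 0 ≤ t₀ → ContinuousOn x₀ (Icc (-r) 0) → MD l D d →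
      IsSolGlobal n l r f d t₀ x → (∀ θ ∈ Icc (-r) 0, x (t₀ + θ) = x₀ θ) →
      ∀ t, t₀ ≤ t →
        histNorm n r (fun θ => x (t + θ)) ≤ σ (histNorm n r x₀) (t - t₀))

/-- Packaging of the Lyapunov functional properties (b)(i)-(iii) of Theorem 2.10:
continuity, the uniform `K∞` bounds, the infinitesimal decrease property and the
local Lipschitz property. -/
def GoodV (n l : ℕ) (r : ℝ) (D : Set (Euc l)) (f : ℝ → (ℝ → Euc n) → Euc l → Euc n)
    (V : ℝ → (ℝ → Euc n) → ℝ) : Prop :=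
  (∀ t x, 0 ≤ t → ContinuousOn x (Icc (-r) 0) → ∀ ε > 0, ∃ δ > 0,
    ∀ t' x', 0 ≤ t' → ContinuousOn x' (Icc (-r) 0) →
      |t' - t| + histNorm n r (x' - x) < δ → |V t' x' - V t x| < ε) ∧
  (∀ t x, 0 ≤ t → ContinuousOn x (Icc (-r) 0) → 0 ≤ V t x) ∧
  (∃ a₁ a₂, IsKInf a₁ ∧ IsKInf a₂ ∧
    ∀ t x, 0 ≤ t → ContinuousOn x (Icc (-r) 0) →
      a₁ (histNorm n r x) ≤ V t x ∧ V t x ≤ a₂ (histNorm n r x)) ∧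
  (∀ t x d, 0 ≤ t → ContinuousOn x (Icc (-r) 0) → d ∈ D →
    Vdot n r V t x (f t x d) ≤ ((-(V t x) : ℝ) : EReal)) ∧
  (∃ M : ℝ → ℝ, (∀ R, 0 ≤ R → 0 ≤ M R) ∧ MonotoneOn M (Ici 0) ∧
    ∀ R, 0 ≤ R → ∀ t x y, t ∈ Icc 0 R →
      ContinuousOn x (Icc (-r) 0) → ContinuousOn y (Icc (-r) 0) →
      histNorm n r x ≤ R → histNorm n r y ≤ R →
      |V t y - V t x| ≤ M R * histNorm n r (y - x))

/-! ### The sup norm of history segments -/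

section HistNorm

lemma norm_le_histNorm {n : ℕ} {r θ : ℝ} {y : ℝ → Euc n} (hy : ContinuousOn y (Icc (-r) 0))
    (hθ : θ ∈ Icc (-r) 0) : ‖y θ‖ ≤ histNorm n r y :=
  le_csSup (isCompact_Icc.image_of_continuousOn hy.norm).bddAbove ⟨θ, hθ, rfl⟩

lemma histNorm_le {n : ℕ} {r C : ℝ} (hr : 0 ≤ r) {y : ℝ → Euc n}
    (h : ∀ θ ∈ Icc (-r) 0, ‖y θ‖ ≤ C) : histNorm n r y ≤ C := by
  refine csSup_le ((nonempty_Icc.2 (by linarith)).image _) ?_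
  rintro _ ⟨θ, hθ, rfl⟩
  exact h θ hθ

lemma histNorm_nonneg {n : ℕ} {r : ℝ} (y : ℝ → Euc n) : 0 ≤ histNorm n r y := by
  refine Real.sSup_nonneg ?_
  rintro _ ⟨θ, -, rfl⟩
  exact norm_nonneg _

lemma histNorm_congr {n : ℕ} {r : ℝ} {x y : ℝ → Euc n} (h : EqOn x y (Icc (-r) 0)) :
    histNorm n r x = histNorm n r y := by
  unfold histNorm
  congr 1
  exact image_congr fun θ hθ => by rw [h hθ]

lemma histNorm_sub_comm {n : ℕ} {r : ℝ} (x y : ℝ → Euc n) :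
    histNorm n r (x - y) = histNorm n r (y - x) := by
  unfold histNorm
  congr 1
  exact image_congr fun θ _ => by simp [norm_sub_rev]

lemma histNorm_le_add {n : ℕ} {r : ℝ} (hr : 0 ≤ r) {x y : ℝ → Euc n}
    (hx : ContinuousOn x (Icc (-r) 0)) (hy : ContinuousOn y (Icc (-r) 0)) :
    histNorm n r x ≤ histNorm n r y + histNorm n r (x - y) := by
  refine histNorm_le hr fun θ hθ => ?_
  have h₁ := norm_le_histNorm hy hθ
  have h₂ := norm_le_histNorm (hx.sub hy) hθ
  have h₃ : ‖x θ‖ ≤ ‖y θ‖ + ‖x θ - y θ‖ := by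
    simpa using norm_add_le (y θ) (x θ - y θ)
  simp only [Pi.sub_apply] at h₂
  linarith

lemma eqOn_zero_of_histNorm_eq_zero {n : ℕ} {r : ℝ} {x : ℝ → Euc n}
    (hx : ContinuousOn x (Icc (-r) 0)) (h : histNorm n r x = 0) :
    EqOn x (fun _ => 0) (Icc (-r) 0) := fun θ hθ => by
  have := norm_le_histNorm hx hθ
  rw [h] at this
  simpa using this

end HistNorm

/-! ### Dependence on the history segment only -/

/-- Under (H3) the right-hand side only depends on the restriction of its functional argument
to `[-r,0]`. -/
lemma H3.congr {n l : ℕ} {r : ℝ} {D : Set (Euc l)} {f : ℝ → (ℝ → Euc n) → Euc l → Euc n}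
    (h3 : H3 n l r D f) (hr : 0 ≤ r) {t : ℝ} {x y : ℝ → Euc n} {d : Euc l} (ht : 0 ≤ t)
    (hx : ContinuousOn x (Icc (-r) 0)) (hd : d ∈ D) (hxy : EqOn x y (Icc (-r) 0)) :
    f t x d = f t y d := by
  obtain ⟨A, hA, hcont, hright⟩ := h3
  have hy : ContinuousOn y (Icc (-r) 0) := hx.congr hxy.symm
  have hzero : histNorm n r (y - x) ≤ 0 :=
    histNorm_le hr fun θ hθ => by simp [hxy hθ]
  have off : ∀ s, 0 ≤ s → s ∉ A → f s x d = f s y d := fun s hs hsA => by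
    refine (eq_of_forall_dist_le fun ε hε => ?_).symm
    obtain ⟨δ, hδ, h⟩ := hcont s x d hs hsA hx hd ε hε
    rw [dist_eq_norm]
    exact (h s y d hs hy hd (by simpa using hδ) (by linarith) (by simpa using hδ)).le
  refine eq_of_forall_dist_le fun ε hε => ?_
  obtain ⟨δ₁, hδ₁, h₁⟩ := hright t x d ht hx hd (ε / 2) (half_pos hε)
  obtain ⟨δ₂, hδ₂, h₂⟩ := hright t y d ht hy hd (ε / 2) (half_pos hε)
  set δ := min δ₁ δ₂ with hδ
  have hδpos : 0 < δ := lt_min hδ₁ hδ₂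
  obtain ⟨s, hs, hsA⟩ : ∃ s ∈ Ioo t (t + δ), s ∉ A := by
    by_contra! hcon
    refine (Ioo_infinite (show t < t + δ by linarith)) ((hA (t + δ)).subset fun s hs => ?_)
    exact ⟨hcon s hs, by linarith [hs.1], hs.2.le⟩
  have e₁ := h₁ s hs.1.le (by linarith [hs.2, min_le_left δ₁ δ₂])
  have e₂ := h₂ s hs.1.le (by linarith [hs.2, min_le_right δ₁ δ₂])
  rw [off s (ht.trans hs.1.le) hsA] at e₁
  rw [← dist_eq_norm] at e₁ e₂
  linarith [dist_triangle_left (f t x d) (f t y d) (f s y d)]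

/-! ### A comparison estimate -/

/-- An energy inequality for a bounded integrable velocity field. -/
lemma norm_sq_le_add_integral {E : Type*} [NormedAddCommGroup E] [InnerProductSpace ℝ E]
    [CompleteSpace E] {g e : ℝ → E} {k : ℝ → ℝ} {a b C : ℝ} (hab : a ≤ b)
    (hg : IntervalIntegrable g volume a b) (hC : ∀ s ∈ Icc a b, ‖g s‖ ≤ C)
    (he : ∀ t ∈ Icc a b, e t = e a + ∫ s in a..t, g s) (hk : IntervalIntegrable k volume a b)
    (hek : ∀ s ∈ Ico a b, 2 * inner ℝ (e s) (g s) ≤ k s) :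
    ‖e b‖ ^ 2 ≤ ‖e a‖ ^ 2 + ∫ s in a..b, k s := by
  have hC0 : 0 ≤ C := (norm_nonneg _).trans (hC a ⟨le_rfl, hab⟩)
  have hlip : ∀ s ∈ Icc a b, ∀ t ∈ Icc a b, ‖e s - e t‖ ≤ C * |s - t| := by
    intro s hs t ht
    have hsub : ∀ u ∈ Icc a b, IntervalIntegrable g volume a u := fun u hu =>
      hg.mono_set (by rw [uIcc_of_le hab, uIcc_of_le hu.1]; exact Icc_subset_Icc_right hu.2)
    have : e s - e t = ∫ u in t..s, g u := by
      rw [he s hs, he t ht, add_sub_add_left_eq_sub,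
        intervalIntegral.integral_interval_sub_left (hsub s hs) (hsub t ht)]
    rw [this]
    refine intervalIntegral.norm_integral_le_of_norm_le_const fun u hu => hC u ?_
    exact (uIcc_subset_Icc ht hs) (uIoc_subset_uIcc hu)
  have hbd : ∀ s ∈ Icc a b, ‖e s‖ ≤ ‖e a‖ + C * (b - a) := by
    intro s hs
    have h₁ := hlip s hs a ⟨le_rfl, hab⟩
    have h₂ : ‖e s‖ ≤ ‖e a‖ + ‖e s - e a‖ := by simpa using norm_add_le (e a) (e s - e a)
    have h₃ : C * |s - a| ≤ C * (b - a) := by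
      rw [abs_of_nonneg (by linarith [hs.1])]
      gcongr
      exact hs.2
    linarith
  set B := ‖e a‖ + C * (b - a) with hB
  have hB0 : 0 ≤ B := by
    have : 0 ≤ b - a := by linarith
    positivity
  have hLip : LipschitzOnWith (Real.toNNReal (2 * B * C)) (fun t => ‖e t‖ ^ 2) (uIcc a b) := by
    rw [uIcc_of_le hab]
    refine LipschitzOnWith.of_dist_le_mul fun s hs t ht => ?_
    rw [Real.coe_toNNReal _ (by positivity), Real.dist_eq, Real.dist_eq, sq_sub_sq, abs_mul]
    have h₁ := hbd s hs
    have h₂ := hbd t ht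
    have h₃ := (abs_norm_sub_norm_le (e s) (e t)).trans (hlip s hs t ht)
    have h₄ : |‖e s‖ + ‖e t‖| ≤ 2 * B := by rw [abs_of_nonneg (by positivity)]; linarith
    calc _ ≤ 2 * B * (C * |s - t|) := by gcongr
      _ = _ := by ring
  have hac := hLip.absolutelyContinuousOnInterval
  have hintegral := hac.integral_deriv_eq_sub
  have hmono : ∫ s in a..b, deriv (fun t => ‖e t‖ ^ 2) s ≤ ∫ s in a..b, k s := by
    refine intervalIntegral.integral_mono_ae_restrict hab hac.intervalIntegrable_deriv hk ?_
    have hne : ∀ᵐ x : ℝ, x ≠ a ∧ x ≠ b := by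
      have h₁ : ∀ᵐ x : ℝ, x ≠ a := by simp [ae_iff, measure_singleton]
      have h₂ : ∀ᵐ x : ℝ, x ≠ b := by simp [ae_iff, measure_singleton]
      exact h₁.and h₂
    rw [EventuallyLE, ae_restrict_iff' measurableSet_Icc]
    filter_upwards [hg.ae_hasDerivAt_integral, hne] with s hs hne hsab
    have hder := hs (by rwa [uIcc_of_le hab]) a (by simp)
    have hev : e =ᶠ[nhds s] fun t => e a + ∫ u in a..t, g u := by
      filter_upwards [Ioo_mem_nhds (lt_of_le_of_ne hsab.1 hne.1.symm)
        (lt_of_le_of_ne hsab.2 hne.2)] with t ht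
      exact he t (Ioo_subset_Icc_self ht)
    have hder' : HasDerivAt e (g s) s := (hder.const_add (e a)).congr_of_eventuallyEq hev
    rw [hder'.norm_sq.deriv]
    exact hek s ⟨hsab.1, lt_of_le_of_ne hsab.2 hne.2⟩
  linarith

/-! ### Trajectories -/

/-- `x` is a global solution with initial data `(t₀, x₀)` and admissible disturbance `d`. -/
def IsTraj (n l : ℕ) (r : ℝ) (D : Set (Euc l)) (f : ℝ → (ℝ → Euc n) → Euc l → Euc n)
    (t₀ : ℝ) (x₀ : ℝ → Euc n) (d : ℝ → Euc l) (x : ℝ → Euc n) : Prop :=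
  MD l D d ∧ IsSolGlobal n l r f d t₀ x ∧ ∀ θ ∈ Icc (-r) 0, x (t₀ + θ) = x₀ θ

/-- The standing hypotheses, with the one-sided Lipschitz function `L` and the stability
function `σ` made explicit. -/
structure StableSystem (n l : ℕ) (r : ℝ) (D : Set (Euc l))
    (f : ℝ → (ℝ → Euc n) → Euc l → Euc n) (σ L : ℝ → ℝ → ℝ) : Prop where
  delay_nonneg : 0 ≤ r
  nonempty : D.Nonempty
  zero : ∀ t d, 0 ≤ t → d ∈ D → f t (fun _ => (0 : Euc n)) d = 0
  lip_mono_right : ∀ t, 0 ≤ t → MonotoneOn (L t) (Ici 0)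
  lip_mono_left : ∀ s, 0 ≤ s → MonotoneOn (fun t => L t s) (Ici 0)
  lip_nonneg : ∀ t s, 0 ≤ t → 0 ≤ s → 0 ≤ L t s
  one_sided : ∀ t x y d, 0 ≤ t → ContinuousOn x (Icc (-r) 0) → ContinuousOn y (Icc (-r) 0) →
    d ∈ D → (inner ℝ (x 0 - y 0) (f t x d - f t y d) : ℝ) ≤
      L t (histNorm n r x + histNorm n r y) * (histNorm n r (x - y))^2
  bounded : H2 n l r D f
  regular : H3 n l r D f
  small : H4 n l r D f
  kl : IsKL σ
  exists_sol : ∀ t₀ x₀ d, 0 ≤ t₀ → ContinuousOn x₀ (Icc (-r) 0) → MD l D d →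
    ∃ x : ℝ → Euc n, IsSolGlobal n l r f d t₀ x ∧ ∀ θ ∈ Icc (-r) 0, x (t₀ + θ) = x₀ θ
  estimate : ∀ t₀ x₀ d x, 0 ≤ t₀ → ContinuousOn x₀ (Icc (-r) 0) → MD l D d →
    IsSolGlobal n l r f d t₀ x → (∀ θ ∈ Icc (-r) 0, x (t₀ + θ) = x₀ θ) →
    ∀ t, t₀ ≤ t → histNorm n r (fun θ => x (t + θ)) ≤ σ (histNorm n r x₀) (t - t₀)

lemma MD.const {l : ℕ} {D : Set (Euc l)} {v : Euc l} (hv : v ∈ D) : MD l D (fun _ => v) :=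
  ⟨fun _ _ => hv, fun _ _ ε hε => ⟨1, one_pos, fun _ _ _ => by simpa using hε⟩, ∅, by simp,
    fun _ _ _ ε hε => ⟨1, one_pos, fun _ _ _ => by simpa using hε⟩⟩

/-- Admissible disturbances can be concatenated. -/
lemma MD.concat {l : ℕ} {D : Set (Euc l)} {d₁ d₂ : ℝ → Euc l} (h₁ : MD l D d₁)
    (h₂ : MD l D d₂) (t₁ : ℝ) : MD l D (fun s => if s < t₁ then d₁ s else d₂ s) := by
  obtain ⟨hm₁, hr₁, A₁, hA₁, hc₁⟩ := h₁
  obtain ⟨hm₂, hr₂, A₂, hA₂, hc₂⟩ := h₂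
  refine ⟨fun t ht => ?_, fun t ht ε hε => ?_, insert t₁ (A₁ ∪ A₂), fun C => ?_,
    fun t ht htA ε hε => ?_⟩
  · dsimp only
    split_ifs
    exacts [hm₁ t ht, hm₂ t ht]
  · by_cases h : t < t₁
    · obtain ⟨δ, hδ, hd⟩ := hr₁ t ht ε hε
      refine ⟨min δ (t₁ - t), lt_min hδ (by linarith), fun s hs hsδ => ?_⟩
      have := lt_min_iff.1 hsδ
      simp only
      rw [if_pos h, if_pos (by linarith)]
      exact hd s hs this.1
    · obtain ⟨δ, hδ, hd⟩ := hr₂ t ht ε hε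
      refine ⟨δ, hδ, fun s hs hsδ => ?_⟩
      simp only
      rw [if_neg h, if_neg (by linarith)]
      exact hd s hs hsδ
  · refine (((hA₁ C).union (hA₂ C)).insert t₁).subset ?_
    rintro s ⟨hs | hs | hs, hsC⟩
    exacts [Or.inl hs, Or.inr (Or.inl ⟨hs, hsC⟩), Or.inr (Or.inr ⟨hs, hsC⟩)]
  · simp only [mem_insert_iff, mem_union, not_or] at htA
    obtain ⟨hne, htA₁, htA₂⟩ := htA
    rcases lt_or_gt_of_ne hne with h | h
    · obtain ⟨δ, hδ, hd⟩ := hc₁ t ht htA₁ ε hε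
      refine ⟨min δ (t₁ - t), lt_min hδ (by linarith), fun s hs hsδ => ?_⟩
      have := lt_min_iff.1 hsδ
      simp only
      rw [if_pos h, if_pos (by linarith [(abs_lt.1 this.2).2])]
      exact hd s hs this.1
    · obtain ⟨δ, hδ, hd⟩ := hc₂ t ht htA₂ ε hε
      refine ⟨min δ (t - t₁), lt_min hδ (by linarith), fun s hs hsδ => ?_⟩
      have := lt_min_iff.1 hsδ
      simp only
      rw [if_neg h.not_gt, if_neg (by linarith [(abs_lt.1 this.2).1])]
      exact hd s hs this.1

/-- Admissible disturbances can be advanced in time. -/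
lemma MD.advance {l : ℕ} {D : Set (Euc l)} {d : ℝ → Euc l} (h : MD l D d) {T : ℝ}
    (hT : 0 ≤ T) : MD l D (fun s => d (s + T)) := by
  obtain ⟨hm, hr, A, hA, hc⟩ := h
  refine ⟨fun t ht => hm _ (by linarith), fun t ht ε hε => ?_, (fun s => s + T) ⁻¹' A,
    fun C => ?_, fun t ht htA ε hε => ?_⟩
  · obtain ⟨δ, hδ, hd⟩ := hr (t + T) (by linarith) ε hε
    exact ⟨δ, hδ, fun s hs hsδ => hd (s + T) (by linarith) (by linarith)⟩
  · refine ((hA (C + T)).preimage (f := fun s => s + T) (add_left_injective T).injOn).subset ?_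
    rintro s ⟨hs, hs₀, hsC⟩
    refine ⟨hs, ?_, ?_⟩ <;> dsimp only <;> linarith
  · obtain ⟨δ, hδ, hd⟩ := hc (t + T) (by linarith) htA ε hε
    exact ⟨δ, hδ, fun s hs hsδ => hd (s + T) (by linarith) (by simpa using hsδ)⟩

/-- Admissible disturbances can be delayed in time, with a constant value before. -/
lemma MD.delay {l : ℕ} {D : Set (Euc l)} {d : ℝ → Euc l} (h : MD l D d) {T : ℝ} :
    MD l D (fun s => d (max (s - T) 0)) := by
  obtain ⟨hm, hr, A, hA, hc⟩ := h
  refine ⟨fun t ht => hm _ (le_max_right _ _), fun t ht ε hε => ?_,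
    insert T ((fun s => s - T) ⁻¹' (A ∩ Ici 0)), fun C => ?_, fun t ht htA ε hε => ?_⟩
  · obtain ⟨δ, hδ, hd⟩ := hr (max (t - T) 0) (le_max_right _ _) ε hε
    refine ⟨δ, hδ, fun s hs hsδ => hd _ (max_le_max_right _ (by linarith)) ?_⟩
    have := abs_max_sub_max_le_abs (s - T) (t - T) 0
    rw [sub_sub_sub_cancel_right, abs_of_nonneg (sub_nonneg.2 hs)] at this
    linarith [le_abs_self (max (s - T) 0 - max (t - T) 0)]
  · refine (((hA (C - T)).preimage (f := fun s => s - T) sub_left_injective.injOn).insert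
      T).subset ?_
    rintro s ⟨hs | hs, hs₀, hsC⟩
    · exact Or.inl hs
    · exact Or.inr ⟨hs.1, hs.2, by dsimp only; linarith⟩
  · simp only [mem_insert_iff, mem_preimage, mem_inter_iff, mem_Ici, not_or, not_and] at htA
    obtain ⟨hne, htA⟩ := htA
    rcases lt_or_gt_of_ne hne with h | h
    · refine ⟨T - t, by linarith, fun s hs hsδ => ?_⟩
      simp only
      rw [max_eq_right (show s - T ≤ 0 by linarith [(abs_lt.1 hsδ).2]),
        max_eq_right (show t - T ≤ 0 by linarith)]
      simpa using hε
    · have hA' : t - T ∉ A := fun hmem => htA hmem (by linarith)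
      obtain ⟨δ, hδ, hd⟩ := hc (t - T) (by linarith) hA' ε hε
      refine ⟨δ, hδ, fun s hs hsδ => ?_⟩
      simp only
      rw [max_eq_left (show 0 ≤ t - T by linarith)]
      refine hd _ (le_max_right _ _) (lt_of_le_of_lt ?_ hsδ)
      have := abs_max_sub_max_le_abs (s - T) (t - T) 0
      rwa [sub_sub_sub_cancel_right, max_eq_left (show 0 ≤ t - T by linarith)] at this

section Trajectories

variable {n l : ℕ} {r : ℝ} {D : Set (Euc l)} {f : ℝ → (ℝ → Euc n) → Euc l → Euc n}
  {σ L : ℝ → ℝ → ℝ} {t₀ t₁ : ℝ} {x₀ y₀ x y : ℝ → Euc n} {d d' : ℝ → Euc l}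

lemma IsTraj.continuousOn_hist (h : IsTraj n l r D f t₀ x₀ d x) {t : ℝ} (ht : t₀ ≤ t) :
    ContinuousOn (fun θ => x (t + θ)) (Icc (-r) 0) :=
  h.2.1.1.comp (by fun_prop) fun θ hθ => by
    have := hθ.1
    simp only [mem_Ici]
    linarith

lemma IsTraj.continuousOn_init (h : IsTraj n l r D f t₀ x₀ d x) :
    ContinuousOn x₀ (Icc (-r) 0) :=
  (h.continuousOn_hist le_rfl).congr fun θ hθ => (h.2.2 θ hθ).symm

lemma IsTraj.histNorm_init (h : IsTraj n l r D f t₀ x₀ d x) :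
    histNorm n r (fun θ => x (t₀ + θ)) = histNorm n r x₀ :=
  histNorm_congr fun θ hθ => h.2.2 θ hθ

lemma IsTraj.intervalIntegrable (h : IsTraj n l r D f t₀ x₀ d x) {a b : ℝ} (ha : t₀ ≤ a)
    (hb : t₀ ≤ b) :
    IntervalIntegrable (fun s => f s (fun θ => x (s + θ)) (d s)) volume a b :=
  (h.2.1.2 a ha).1.symm.trans (h.2.1.2 b hb).1

lemma IsTraj.sub_eq (h : IsTraj n l r D f t₀ x₀ d x) {a b : ℝ} (ha : t₀ ≤ a) (hb : t₀ ≤ b) :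
    x b - x a = ∫ s in a..b, f s (fun θ => x (s + θ)) (d s) := by
  rw [(h.2.1.2 a ha).2, (h.2.1.2 b hb).2, add_sub_add_left_eq_sub,
    intervalIntegral.integral_interval_sub_left (h.2.1.2 b hb).1 (h.2.1.2 a ha).1]

/-- A trajectory restarted at a later time is a trajectory. -/
lemma IsTraj.restart (h : IsTraj n l r D f t₀ x₀ d x) (ht : t₀ ≤ t₁) :
    IsTraj n l r D f t₁ (fun θ => x (t₁ + θ)) d x := by
  refine ⟨h.1, ⟨h.2.1.1.mono (Ici_subset_Ici.2 (by linarith)), fun t htt => ?_⟩,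
    fun _ _ => rfl⟩
  exact ⟨h.intervalIntegrable ht (ht.trans htt), by
    rw [← h.sub_eq ht (ht.trans htt), add_sub_cancel]⟩

/-- Concatenation of trajectories. -/
lemma StableSystem.concat (S : StableSystem n l r D f σ L) (ht₀ : 0 ≤ t₀) (ht : t₀ ≤ t₁)
    (hx : IsTraj n l r D f t₀ x₀ d x) (hy : IsTraj n l r D f t₁ (fun θ => x (t₁ + θ)) d' y) :
    IsTraj n l r D f t₀ x₀ (fun s => if s < t₁ then d s else d' s)
      (fun s => if s < t₁ then x s else y s) := by
  have hr := S.delay_nonneg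
  set z : ℝ → Euc n := fun s => if s < t₁ then x s else y s with hz
  have hzx : ∀ s ≤ t₁, z s = x s := fun s hs => by
    rcases hs.lt_or_eq with h | rfl
    · simp [hz, h]
    · have := hy.2.2 0 ⟨by linarith, le_rfl⟩
      simpa [hz] using this
  have hzy : ∀ s, t₁ - r ≤ s → z s = y s := fun s hs => by
    by_cases h : s < t₁
    · have := hy.2.2 (s - t₁) ⟨by linarith, by linarith⟩
      simp only [add_sub_cancel] at this
      simp [hz, h, this]
    · simp [hz, h]
  have hzc : ContinuousOn z (Ici (t₀ - r)) := by
    have hunion : Ici (t₀ - r) ⊆ Icc (t₀ - r) t₁ ∪ Ici t₁ := fun s hs => by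
      rcases le_total s t₁ with h | h
      exacts [Or.inl ⟨hs, h⟩, Or.inr h]
    refine (ContinuousOn.union_of_isClosed ?_ ?_ isClosed_Icc isClosed_Ici).mono hunion
    · exact (hx.2.1.1.mono fun s hs => hs.1).congr fun s hs => hzx s hs.2
    · exact (hy.2.1.1.mono (Ici_subset_Ici.2 (by linarith))).congr fun s hs =>
        hzy s (by linarith [mem_Ici.1 hs])
  have hzh : ∀ s, t₀ ≤ s → ContinuousOn (fun θ => z (s + θ)) (Icc (-r) 0) := fun s hs =>
    hzc.comp (by fun_prop) fun θ hθ => by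
      have := hθ.1
      simp only [mem_Ici]
      linarith
  set F := fun s => f s (fun θ => z (s + θ)) (if s < t₁ then d s else d' s) with hF
  have hFx : ∀ s, t₀ ≤ s → s < t₁ → F s = f s (fun θ => x (s + θ)) (d s) := fun s hs hs₁ => by
    simp only [hF, if_pos hs₁]
    exact S.regular.congr hr (ht₀.trans hs) (hzh s hs) (hx.1.1 s (ht₀.trans hs))
      fun θ hθ => hzx _ (by linarith [hθ.2])
  have hFy : ∀ s, t₁ ≤ s → F s = f s (fun θ => y (s + θ)) (d' s) := fun s hs => by
    simp only [hF, if_neg hs.not_gt]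
    exact S.regular.congr hr (ht₀.trans (ht.trans hs)) (hzh s (ht.trans hs))
      (hy.1.1 s (ht₀.trans (ht.trans hs))) fun θ hθ => hzy _ (by linarith [hθ.1])
  have early : ∀ t, t₀ ≤ t → t ≤ t₁ → IntervalIntegrable F volume t₀ t ∧
      z t = z t₀ + ∫ s in t₀..t, F s := by
    intro t h₀ h₁
    have hae : ∀ᵐ s : ℝ, s ∈ uIoc t₀ t → f s (fun θ => x (s + θ)) (d s) = F s := by
      have hne : ∀ᵐ s : ℝ, s ≠ t₁ := by simp [ae_iff, measure_singleton]
      filter_upwards [hne] with s hs hmem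
      rw [uIoc_of_le h₀] at hmem
      exact (hFx s hmem.1.le (lt_of_le_of_ne (hmem.2.trans h₁) hs)).symm
    refine ⟨(hx.intervalIntegrable le_rfl h₀).congr_ae
      ((ae_restrict_iff' measurableSet_uIoc).2 hae), ?_⟩
    rw [hzx t h₁, hzx t₀ ht, ← intervalIntegral.integral_congr_ae hae, ← hx.sub_eq le_rfl h₀,
      add_sub_cancel]
  have late : ∀ t, t₁ ≤ t → IntervalIntegrable F volume t₁ t ∧
      z t = z t₁ + ∫ s in t₁..t, F s := by
    intro t h₁
    have heq : ∀ s ∈ uIcc t₁ t, f s (fun θ => y (s + θ)) (d' s) = F s := by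
      intro s hs
      rw [uIcc_of_le h₁] at hs
      exact (hFy s hs.1).symm
    refine ⟨(hy.intervalIntegrable le_rfl h₁).congr fun s hs => heq s (uIoc_subset_uIcc hs), ?_⟩
    rw [hzy t (by linarith), hzy t₁ (by linarith), ← intervalIntegral.integral_congr heq,
      ← hy.sub_eq le_rfl h₁, add_sub_cancel]
  refine ⟨hx.1.concat hy.1 t₁, ⟨hzc, fun t htt => ?_⟩, fun θ hθ => ?_⟩
  · rcases le_total t t₁ with h | h
    · exact early t htt h
    · obtain ⟨hi₁, he₁⟩ := early t₁ ht le_rfl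
      obtain ⟨hi₂, he₂⟩ := late t h
      refine ⟨hi₁.trans hi₂, ?_⟩
      rw [he₂, he₁, add_assoc, intervalIntegral.integral_add_adjacent_intervals hi₁ hi₂]
  · rw [← hx.2.2 θ hθ]
    exact hzx _ (by linarith [hθ.2])

end Trajectories

section Estimates

variable {n l : ℕ} {r : ℝ} {D : Set (Euc l)} {f : ℝ → (ℝ → Euc n) → Euc l → Euc n}
  {σ L : ℝ → ℝ → ℝ} {t₀ t₁ : ℝ} {x₀ y₀ x y : ℝ → Euc n} {d d' : ℝ → Euc l}

lemma IsKL.mono_left (hσ : IsKL σ) {s s' t : ℝ} (hs : 0 ≤ s) (hss : s ≤ s') (ht : 0 ≤ t) :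
    σ s t ≤ σ s' t :=
  (hσ.2.2.1 t ht).1.monotoneOn (mem_Ici.2 hs) (mem_Ici.2 (hs.trans hss)) hss

lemma IsKL.anti_right (hσ : IsKL σ) {s t t' : ℝ} (hs : 0 ≤ s) (ht : 0 ≤ t) (htt : t ≤ t') :
    σ s t' ≤ σ s t :=
  hσ.2.2.2.1 s hs (mem_Ici.2 ht) (mem_Ici.2 (ht.trans htt)) htt

lemma StableSystem.exists_traj (S : StableSystem n l r D f σ L) (ht₀ : 0 ≤ t₀)
    (hx₀ : ContinuousOn x₀ (Icc (-r) 0)) (hd : MD l D d) : ∃ x, IsTraj n l r D f t₀ x₀ d x := by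
  obtain ⟨x, hx⟩ := S.exists_sol t₀ x₀ d ht₀ hx₀ hd
  exact ⟨x, hd, hx⟩

lemma StableSystem.hist_le (S : StableSystem n l r D f σ L) (ht₀ : 0 ≤ t₀)
    (h : IsTraj n l r D f t₀ x₀ d x) {N : ℝ} (hN : histNorm n r x₀ ≤ N) (ht : t₀ ≤ t₁) :
    histNorm n r (fun θ => x (t₁ + θ)) ≤ σ N (t₁ - t₀) :=
  (S.estimate t₀ x₀ d x ht₀ h.continuousOn_init h.1 h.2.1 h.2.2 t₁ ht).trans
    (S.kl.mono_left (histNorm_nonneg _) hN (by linarith))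

lemma StableSystem.hist_le_zero (S : StableSystem n l r D f σ L) (ht₀ : 0 ≤ t₀)
    (h : IsTraj n l r D f t₀ x₀ d x) {N : ℝ} (hN : histNorm n r x₀ ≤ N) (ht : t₀ ≤ t₁) :
    histNorm n r (fun θ => x (t₁ + θ)) ≤ σ N 0 :=
  (S.hist_le ht₀ h hN ht).trans
    (S.kl.anti_right ((histNorm_nonneg _).trans hN) le_rfl (by linarith))

/-- Exponential estimate for the distance of two trajectories with the same disturbance. -/
lemma StableSystem.histNorm_sub_le (S : StableSystem n l r D f σ L) (ht₀ : 0 ≤ t₀)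
    (hx : IsTraj n l r D f t₀ x₀ d x) (hy : IsTraj n l r D f t₀ y₀ d y) {N : ℝ}
    (hxN : histNorm n r x₀ ≤ N) (hyN : histNorm n r y₀ ≤ N) (ht : t₀ ≤ t₁) :
    histNorm n r ((fun θ => x (t₁ + θ)) - fun θ => y (t₁ + θ)) ≤
      Real.exp (L t₁ (2 * σ N 0) * (t₁ - t₀)) * histNorm n r (x₀ - y₀) := by
  have hr := S.delay_nonneg
  have hN : 0 ≤ N := (histNorm_nonneg _).trans hxN
  have hσN : 0 ≤ σ N 0 := S.kl.2.1 N 0 hN le_rfl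
  set Λ := L t₁ (2 * σ N 0) with hΛ
  have hΛ0 : 0 ≤ Λ := S.lip_nonneg _ _ (ht₀.trans ht) (by linarith)
  set m := histNorm n r (x₀ - y₀) with hm
  have hm0 : 0 ≤ m := histNorm_nonneg _
  set e : ℝ → Euc n := fun s => x s - y s with he
  have hinit : ∀ s, t₀ - r ≤ s → s ≤ t₀ → ‖e s‖ ≤ m := by
    intro s hs hs₀
    have hmem : s - t₀ ∈ Icc (-r) 0 := ⟨by linarith, by linarith⟩
    have h₁ := hx.2.2 _ hmem
    have h₂ := hy.2.2 _ hmem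
    rw [add_sub_cancel] at h₁ h₂
    have h₃ := norm_le_histNorm (hx.continuousOn_init.sub hy.continuousOn_init) hmem
    simpa only [he, h₁, h₂, Pi.sub_apply] using h₃
  have hcont : ContinuousOn e (Ici (t₀ - r)) := hx.2.1.1.sub hy.2.1.1
  set g : ℝ → Euc n := fun s => f s (fun θ => x (s + θ)) (d s) - f s (fun θ => y (s + θ)) (d s)
    with hg
  obtain ⟨C, hC⟩ := S.bounded t₁ (σ N 0)
  have key : ∀ K, m ^ 2 < K → ∀ t ∈ Icc t₀ t₁, ‖e t‖ ^ 2 < K * Real.exp (2 * Λ * (t - t₀)) := by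
    intro K hK t htt
    by_contra! hcon
    set B : ℝ → ℝ := fun s => K * Real.exp (2 * Λ * (s - t₀)) with hB
    have hK0 : 0 < K := (sq_nonneg m).trans_lt hK
    have hBmono : ∀ s s', s ≤ s' → B s ≤ B s' := by
      intro s s' hs
      simp only [hB]
      gcongr
    have hcl : IsCompact {s ∈ Icc t₀ t₁ | B s ≤ ‖e s‖ ^ 2} := by
      refine isCompact_Icc.of_isClosed_subset ?_ fun s hs => hs.1
      refine IsClosed.isClosed_le isClosed_Icc (by fun_prop) ?_
      exact (hcont.mono fun s hs => by simp only [mem_Ici]; linarith [hs.1]).norm.pow 2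
    obtain ⟨u, ⟨hu, hBu⟩, hmin⟩ := hcl.exists_isLeast ⟨t, htt, hcon⟩
    have hlt : ∀ s, t₀ ≤ s → s < u → ‖e s‖ ^ 2 < B s := by
      intro s hs hsu
      by_contra! hle
      exact absurd (hmin ⟨⟨hs, hsu.le.trans hu.2⟩, hle⟩) hsu.not_ge
    have hB₀ : B t₀ = K := by simp [hB]
    have hhist : ∀ s ∈ Ico t₀ u,
        histNorm n r ((fun θ => x (s + θ)) - fun θ => y (s + θ)) ^ 2 ≤ B s := by
      intro s hs
      have hB0 : 0 ≤ B s := by simp only [hB]; positivity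
      rw [← Real.sq_sqrt hB0]
      refine pow_le_pow_left₀ (histNorm_nonneg _) (histNorm_le hr fun θ hθ => ?_) 2
      refine Real.le_sqrt_of_sq_le ?_
      change ‖e (s + θ)‖ ^ 2 ≤ B s
      rcases le_total t₀ (s + θ) with h | h
      · exact (hlt _ h (by linarith [hs.2, hθ.2])).le.trans (hBmono _ _ (by linarith [hθ.2]))
      · have := hinit (s + θ) (by linarith [hs.1, hθ.1]) h
        calc ‖e (s + θ)‖ ^ 2 ≤ m ^ 2 := by gcongr
          _ ≤ B t₀ := by rw [hB₀]; exact hK.le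
          _ ≤ B s := hBmono _ _ hs.1
    have hintegral : ∫ s in t₀..u, 2 * Λ * B s = B u - B t₀ := by
      refine intervalIntegral.integral_eq_sub_of_hasDerivAt (fun s _ => ?_) ?_
      · have h₁ : HasDerivAt (fun s => 2 * Λ * (s - t₀)) (2 * Λ) s := by
          simpa using ((hasDerivAt_id s).sub_const t₀).const_mul (2 * Λ)
        exact (h₁.exp.const_mul K).congr_deriv (by simp only [hB]; ring)
      · exact Continuous.intervalIntegrable (by fun_prop) _ _
    have henergy := norm_sq_le_add_integral (g := g) (e := e) (k := fun s => 2 * Λ * B s)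
      (C := C + C) hu.1
      ((hx.intervalIntegrable le_rfl hu.1).sub (hy.intervalIntegrable le_rfl hu.1))
      (fun s hs => ?_) (fun s hs => ?_) (Continuous.intervalIntegrable (by fun_prop) _ _)
      (fun s hs => ?_)
    · rw [hintegral, hB₀] at henergy
      have := hinit t₀ (by linarith) le_rfl
      have h₂ : ‖e t₀‖ ^ 2 ≤ m ^ 2 := by gcongr
      linarith
    · have hs0 : 0 ≤ s := ht₀.trans hs.1
      refine (norm_sub_le _ _).trans (add_le_add ?_ ?_)
      · exact hC s _ _ hs0 (hs.2.trans hu.2) (hx.continuousOn_hist hs.1)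
          (S.hist_le_zero ht₀ hx hxN hs.1) (hx.1.1 s hs0)
      · exact hC s _ _ hs0 (hs.2.trans hu.2) (hy.continuousOn_hist hs.1)
          (S.hist_le_zero ht₀ hy hyN hs.1) (hx.1.1 s hs0)
    · simp only [he, hg]
      rw [intervalIntegral.integral_sub (hx.intervalIntegrable le_rfl hs.1)
        (hy.intervalIntegrable le_rfl hs.1), ← hx.sub_eq le_rfl hs.1, ← hy.sub_eq le_rfl hs.1]
      abel
    · have hs0 : 0 ≤ s := ht₀.trans hs.1
      have h₁ := S.one_sided s _ _ _ hs0 (hx.continuousOn_hist hs.1) (hy.continuousOn_hist hs.1)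
        (hx.1.1 s hs0)
      simp only [add_zero] at h₁
      have hsum : histNorm n r (fun θ => x (s + θ)) + histNorm n r (fun θ => y (s + θ)) ≤
          2 * σ N 0 := by
        linarith [S.hist_le_zero ht₀ hx hxN hs.1, S.hist_le_zero ht₀ hy hyN hs.1]
      have hsum0 : 0 ≤ histNorm n r (fun θ => x (s + θ)) + histNorm n r (fun θ => y (s + θ)) :=
        add_nonneg (histNorm_nonneg _) (histNorm_nonneg _)
      have hL : L s (histNorm n r (fun θ => x (s + θ)) + histNorm n r (fun θ => y (s + θ))) ≤
          Λ :=
        (S.lip_mono_right s hs0 hsum0 (hsum0.trans hsum) hsum).trans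
          (S.lip_mono_left _ (hsum0.trans hsum) hs0 (ht₀.trans ht) (hs.2.le.trans hu.2))
      have h₂ := mul_le_mul hL (hhist s hs) (sq_nonneg _) hΛ0
      simp only [he, hg]
      linarith
  have hexp : 1 ≤ Real.exp (Λ * (t₁ - t₀)) :=
    Real.one_le_exp (mul_nonneg hΛ0 (by linarith))
  refine histNorm_le hr fun θ hθ => ?_
  change ‖e (t₁ + θ)‖ ≤ _
  rcases le_total (t₁ + θ) t₀ with h | h
  · have := hinit _ (by linarith [hθ.1]) h
    nlinarith
  · have hmem : t₁ + θ ∈ Icc t₀ t₁ := ⟨h, by linarith [hθ.2]⟩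
    have hle : ‖e (t₁ + θ)‖ ^ 2 / Real.exp (2 * Λ * (t₁ + θ - t₀)) ≤ m ^ 2 := by
      refine le_of_forall_gt_imp_ge_of_dense fun K hK => ?_
      rw [div_le_iff₀ (Real.exp_pos _)]
      exact (key K hK _ hmem).le
    rw [div_le_iff₀ (Real.exp_pos _)] at hle
    have hexp₂ : Real.exp (2 * Λ * (t₁ + θ - t₀)) ≤ Real.exp (Λ * (t₁ - t₀)) ^ 2 := by
      rw [← Real.exp_nat_mul]
      refine Real.exp_le_exp.2 ?_
      push_cast
      nlinarith [hθ.2]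
    refine le_of_sq_le_sq ?_ (by positivity)
    calc ‖e (t₁ + θ)‖ ^ 2 ≤ m ^ 2 * Real.exp (2 * Λ * (t₁ + θ - t₀)) := hle
      _ ≤ m ^ 2 * Real.exp (Λ * (t₁ - t₀)) ^ 2 := by gcongr
      _ = (Real.exp (Λ * (t₁ - t₀)) * m) ^ 2 := by ring

lemma Eop_eq {h θ : ℝ} (v : Euc n) (x : ℝ → Euc n) :
    Eop n x h v θ = x (min (θ + h) 0) + max (θ + h) 0 • v := by
  unfold Eop
  split_ifs with hθ
  · rw [min_eq_right (by linarith), max_eq_left (by linarith)]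
  · rw [min_eq_left (by linarith), max_eq_right (by linarith)]
    simp

lemma continuousOn_Eop {h : ℝ} (hh : 0 ≤ h) (v : Euc n) (hx : ContinuousOn x (Icc (-r) 0)) :
    ContinuousOn (Eop n x h v) (Icc (-r) 0) := by
  have : Eop n x h v = fun θ => x (min (θ + h) 0) + max (θ + h) 0 • v :=
    funext fun θ => Eop_eq v x
  rw [this]
  refine ContinuousOn.add (hx.comp (by fun_prop) fun θ hθ => ⟨?_, min_le_right _ _⟩) (by fun_prop)
  exact le_min (by linarith [hθ.1]) (by linarith [hθ.1, hθ.2])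

/-- A trajectory whose velocity stays close to `v` is close to the linear extension `E_h(x;v)`. -/
lemma IsTraj.histNorm_sub_Eop_le (hr : 0 ≤ r) (hx : IsTraj n l r D f t₀ x₀ d x) {h K : ℝ}
    (hh : 0 ≤ h) {v : Euc n}
    (hK : ∀ s ∈ Ico t₀ (t₀ + h), ‖f s (fun θ => x (s + θ)) (d s) - v‖ ≤ K) (hK0 : 0 ≤ K) :
    histNorm n r ((fun θ => x (t₀ + h + θ)) - Eop n x₀ h v) ≤ K * h := by
  refine histNorm_le hr fun θ hθ => ?_
  simp only [Pi.sub_apply, Eop]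
  split_ifs with hθh
  · have h₀ : x t₀ = x₀ 0 := by simpa using hx.2.2 0 ⟨by linarith, le_rfl⟩
    have hle : t₀ ≤ t₀ + h + θ := by linarith
    have hsub := hx.sub_eq le_rfl hle
    have hintegral : x (t₀ + h + θ) - (x₀ 0 + (θ + h) • v) =
        ∫ s in t₀..(t₀ + h + θ), (f s (fun θ => x (s + θ)) (d s) - v) := by
      rw [intervalIntegral.integral_sub (hx.intervalIntegrable le_rfl hle) (by simp), ← hsub,
        intervalIntegral.integral_const, ← h₀]
      have : t₀ + h + θ - t₀ = θ + h := by ring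
      rw [this]
      abel
    rw [hintegral]
    have hb := intervalIntegral.norm_integral_le_of_norm_le_const_ae (a := t₀)
      (b := t₀ + h + θ) (f := fun s => f s (fun θ => x (s + θ)) (d s) - v) (C := K) (by
        have hne : ∀ᵐ s : ℝ, s ≠ t₀ + h := by simp [ae_iff, measure_singleton]
        filter_upwards [hne] with s hs hmem
        rw [uIoc_of_le hle] at hmem
        exact hK s ⟨hmem.1.le, lt_of_le_of_ne (by linarith [hmem.2, hθ.2]) hs⟩)
    rw [abs_of_nonneg (by linarith)] at hb
    refine hb.trans (mul_le_mul_of_nonneg_left (by linarith [hθ.2]) hK0)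
  · have := hx.2.2 (θ + h) ⟨by linarith [hθ.1], by linarith⟩
    rw [show t₀ + h + θ = t₀ + (θ + h) by ring, this]
    simpa using mul_nonneg hK0 hh

lemma exists_histNorm_Eop_sub_lt (hr : 0 ≤ r) (hx : ContinuousOn x (Icc (-r) 0)) {ε : ℝ}
    (hε : 0 < ε) :
    ∃ δ > 0, ∀ h, 0 ≤ h → h < δ → histNorm n r (Eop n x h 0 - x) < ε := by
  obtain ⟨δ, hδ, hd⟩ := Metric.uniformContinuousOn_iff.1
    (isCompact_Icc.uniformContinuousOn_of_continuous hx) (ε / 2) (by linarith)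
  refine ⟨δ, hδ, fun h hh hhδ => lt_of_le_of_lt (histNorm_le hr fun θ hθ => ?_)
    (half_lt_self hε)⟩
  rw [Pi.sub_apply, Eop_eq, smul_zero, add_zero, ← dist_eq_norm]
  have h₁ : min (θ + h) 0 ∈ Icc (-r) 0 :=
    ⟨le_min (by linarith [hθ.1]) (by linarith), min_le_right _ _⟩
  refine (hd _ h₁ _ hθ ?_).le
  rw [Real.dist_eq, abs_lt]
  constructor
  · rcases min_cases (θ + h) 0 with h | h <;> linarith [hθ.2]
  · linarith [min_le_left (θ + h) 0]

/-- Local uniform continuity of trajectories at the initial time. -/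
lemma StableSystem.exists_histNorm_sub_lt (S : StableSystem n l r D f σ L) (N : ℝ)
    (hx₀ : ContinuousOn x₀ (Icc (-r) 0)) {ε : ℝ} (hε : 0 < ε) :
    ∃ δ > 0, ∀ t₀ h d x, 0 ≤ t₀ → t₀ ≤ N → 0 ≤ h → h < δ → IsTraj n l r D f t₀ x₀ d x →
      histNorm n r ((fun θ => x (t₀ + h + θ)) - x₀) < ε := by
  have hr := S.delay_nonneg
  obtain ⟨C, hC⟩ := S.bounded (N + 1) (σ (histNorm n r x₀) 0)
  obtain ⟨δ, hδ, hE⟩ := exists_histNorm_Eop_sub_lt hr hx₀ (half_pos hε)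
  have hC' : 0 < |C| + 1 := by positivity
  refine ⟨min 1 (min δ (ε / 2 / (|C| + 1))), by positivity,
    fun t₀ h d x ht₀ htN hh hhδ hx => ?_⟩
  simp only [lt_min_iff] at hhδ
  obtain ⟨hh1, hhδ, hhε⟩ := hhδ
  have h₁ := hx.histNorm_sub_Eop_le hr hh (v := 0) (K := |C| + 1) (fun s hs => by
    rw [sub_zero]
    have := hC s _ _ (ht₀.trans hs.1) (by linarith [hs.2]) (hx.continuousOn_hist hs.1)
      (S.hist_le_zero ht₀ hx le_rfl hs.1) (hx.1.1 s (ht₀.trans hs.1))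
    linarith [le_abs_self C]) hC'.le
  rw [lt_div_iff₀ hC'] at hhε
  have h₂ := hE h hh hhδ
  have h₃ := histNorm_le_add hr
    (((hx.continuousOn_hist (t := t₀ + h) (by linarith)).sub hx₀))
    ((continuousOn_Eop hh 0 hx₀).sub hx₀)
  have h₄ : ((fun θ => x (t₀ + h + θ)) - x₀ - (Eop n x₀ h 0 - x₀)) =
      (fun θ => x (t₀ + h + θ)) - Eop n x₀ h 0 := by abel
  change histNorm n r ((fun θ => x (t₀ + h + θ)) - x₀) ≤ histNorm n r (Eop n x₀ h 0 - x₀) +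
    histNorm n r ((fun θ => x (t₀ + h + θ)) - x₀ - (Eop n x₀ h 0 - x₀)) at h₃
  rw [h₄] at h₃
  linarith

/-- Trajectories of a `T`-periodic system can be delayed by a period. -/
lemma IsTraj.delay {T : ℝ}
    (hf : ∀ t x d, 0 ≤ t → ContinuousOn x (Icc (-r) 0) → d ∈ D → f (t + T) x d = f t x d)
    (ht₀ : 0 ≤ t₀) (hx : IsTraj n l r D f t₀ x₀ d x) :
    IsTraj n l r D f (t₀ + T) x₀ (fun s => d (max (s - T) 0)) (fun s => x (s - T)) := by
  have hF : ∀ s, t₀ + T ≤ s → f (s - T) (fun θ => x (s - T + θ)) (d (s - T)) =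
      f s (fun θ => x (s + θ - T)) (d (max (s - T) 0)) := by
    intro s hs
    have h₁ := hf (s - T) _ _ (by linarith) (hx.continuousOn_hist (t := s - T) (by linarith))
      (hx.1.1 (s - T) (by linarith))
    rw [sub_add_cancel] at h₁
    rw [← h₁, max_eq_left (by linarith)]
    congr 1
    exact funext fun θ => by congr 1; ring
  refine ⟨hx.1.delay, ⟨hx.2.1.1.comp (by fun_prop) fun s hs => ?_, fun t ht => ⟨?_, ?_⟩⟩,
    fun θ hθ => ?_⟩
  · simp only [mem_Ici] at hs ⊢
    linarith
  · have h₁ := (hx.intervalIntegrable le_rfl (b := t - T) (by linarith)).comp_sub_right T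
    rw [sub_add_cancel] at h₁
    refine h₁.congr fun s hs => ?_
    rw [uIoc_of_le ht] at hs
    exact hF s hs.1.le
  · have h₁ := hx.sub_eq le_rfl (b := t - T) (by linarith)
    have h₂ := intervalIntegral.integral_comp_sub_right
      (fun s => f s (fun θ => x (s + θ)) (d s)) T (a := t₀ + T) (b := t)
    rw [add_sub_cancel_right, ← h₁] at h₂
    rw [← intervalIntegral.integral_congr (fun s hs => hF s (by
      rw [uIcc_of_le ht] at hs; exact hs.1)), h₂]
    simp
  · rw [← hx.2.2 θ hθ]
    simp only
    congr 1
    ring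

/-- Trajectories of a `T`-periodic system can be advanced by a period. -/
lemma IsTraj.advance {T : ℝ} (hT : 0 ≤ T)
    (hf : ∀ t x d, 0 ≤ t → ContinuousOn x (Icc (-r) 0) → d ∈ D → f (t + T) x d = f t x d)
    (ht₀ : 0 ≤ t₀) (hx : IsTraj n l r D f (t₀ + T) x₀ d x) :
    IsTraj n l r D f t₀ x₀ (fun s => d (s + T)) (fun s => x (s + T)) := by
  have hF : ∀ s, t₀ ≤ s → f (s + T) (fun θ => x (s + T + θ)) (d (s + T)) =
      f s (fun θ => x (s + θ + T)) (d (s + T)) := by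
    intro s hs
    have h₁ := hf s _ _ (by linarith) (hx.continuousOn_hist (t := s + T) (by linarith))
      (hx.1.1 (s + T) (by linarith))
    rw [h₁]
    congr 1
    exact funext fun θ => by congr 1; ring
  refine ⟨hx.1.advance hT, ⟨hx.2.1.1.comp (by fun_prop) fun s hs => ?_, fun t ht => ⟨?_, ?_⟩⟩,
    fun θ hθ => ?_⟩
  · simp only [mem_Ici] at hs ⊢
    linarith
  · have h₁ := (hx.intervalIntegrable le_rfl (b := t + T) (by linarith)).comp_add_right T
    rw [add_sub_cancel_right, add_sub_cancel_right] at h₁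
    refine h₁.congr fun s hs => ?_
    rw [uIoc_of_le ht] at hs
    exact hF s hs.1.le
  · have h₁ := hx.sub_eq le_rfl (b := t + T) (by linarith)
    have h₂ := intervalIntegral.integral_comp_add_right
      (fun s => f s (fun θ => x (s + θ)) (d s)) T (a := t₀) (b := t)
    rw [← h₁] at h₂
    rw [← intervalIntegral.integral_congr (fun s hs => hF s (by
      rw [uIcc_of_le ht] at hs; exact hs.1)), h₂, add_sub_cancel]
  · rw [← hx.2.2 θ hθ]
    simp only
    congr 1
    ring

end Estimates

/-! ### Weights and comparison functions -/

section Weights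

variable {σ L : ℝ → ℝ → ℝ}

/-- Weights `c` and horizons `τ` which make the cut-off gains locally Lipschitz, with
Lipschitz constants `M`. -/
structure GainWeights (σ L : ℝ → ℝ → ℝ) (c M : ℕ → ℝ) (τ : ℕ → ℕ → ℝ) : Prop where
  horizon_nonneg : ∀ N q, 0 ≤ τ N q
  decay : ∀ N q : ℕ, σ N (τ N q) ≤ 1 / ((q : ℝ) + 1)
  pos : ∀ q, 0 < c q
  le_one : ∀ q, c q ≤ 1
  mono : Monotone M
  bound : ∀ N q : ℕ, c q * (Real.exp (2 * τ N q) *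
    Real.exp (L (N + τ N q) (2 * σ N 0) * τ N q)) ≤ M N

lemma exists_gainWeights (hσ : IsKL σ) (hLr : ∀ t, 0 ≤ t → MonotoneOn (L t) (Ici 0))
    (hLl : ∀ s, 0 ≤ s → MonotoneOn (fun t => L t s) (Ici 0))
    (hL0 : ∀ t s, 0 ≤ t → 0 ≤ s → 0 ≤ L t s) : ∃ c M τ, GainWeights σ L c M τ := by
  have hex : ∀ N q : ℕ, ∃ τ : ℝ, 0 ≤ τ ∧ σ N τ ≤ 1 / ((q : ℝ) + 1) := by
    intro N q
    have h₁ := (hσ.2.2.2.2 N N.cast_nonneg).eventually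
      (gt_mem_nhds (show (0 : ℝ) < 1 / ((q : ℝ) + 1) by positivity))
    obtain ⟨τ, hτ, hτ0⟩ := (h₁.and (eventually_ge_atTop 0)).exists
    exact ⟨τ, hτ0, hτ.le⟩
  choose τ hτ0 hτ using hex
  set ρ : ℕ → ℕ → ℝ := fun N q => τ (max N q) q with hρ
  set ℓ : ℕ → ℕ → ℝ := fun N q => Real.exp (2 * ρ N q) *
    Real.exp (L (N + ρ N q) (2 * σ N 0) * ρ N q) with hℓ
  have hℓpos : ∀ N q, 0 < ℓ N q := fun N q => by positivity
  have hσ0 : ∀ N : ℕ, 0 ≤ σ N 0 := fun N => hσ.2.1 _ _ N.cast_nonneg le_rfl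
  have hℓ1 : ∀ N q, 1 ≤ ℓ N q := fun N q => by
    have h₀ : 0 ≤ ρ N q := hτ0 _ _
    refine one_le_mul_of_one_le_of_one_le (Real.one_le_exp (by linarith)) (Real.one_le_exp ?_)
    exact mul_nonneg (hL0 _ _ (by positivity) (by linarith [hσ0 N])) h₀
  have hsum0 : ∀ k : ℕ, 0 ≤ ∑ q ∈ Finset.range k, (ℓ q q)⁻¹ * ℓ k q := fun k =>
    Finset.sum_nonneg fun q _ => mul_nonneg (inv_nonneg.2 (hℓpos _ _).le) (hℓpos _ _).le
  refine ⟨fun q => (ℓ q q)⁻¹, fun N => 1 + ∑ k ∈ Finset.range (N + 1),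
    ∑ q ∈ Finset.range k, (ℓ q q)⁻¹ * ℓ k q, ρ, fun N q => hτ0 _ _, fun N q => ?_,
    fun q => inv_pos.2 (hℓpos _ _), fun q => inv_le_one_of_one_le₀ (hℓ1 _ _), fun N N' h => ?_,
    fun N q => ?_⟩
  · refine le_trans (hσ.mono_left N.cast_nonneg ?_ (hτ0 _ _)) (hτ (max N q) q)
    exact_mod_cast le_max_left N q
  · gcongr
  · change (ℓ q q)⁻¹ * ℓ N q ≤ _
    rcases lt_or_ge q N with h | h
    · have h₁ : (ℓ q q)⁻¹ * ℓ N q ≤ ∑ q ∈ Finset.range N, (ℓ q q)⁻¹ * ℓ N q :=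
        Finset.single_le_sum (f := fun q => (ℓ q q)⁻¹ * ℓ N q)
          (fun q _ => mul_nonneg (inv_nonneg.2 (hℓpos _ _).le) (hℓpos _ _).le)
          (Finset.mem_range.2 h)
      have h₂ := Finset.single_le_sum (f := fun k => ∑ q ∈ Finset.range k, (ℓ q q)⁻¹ * ℓ k q)
          (fun k _ => hsum0 k) (Finset.mem_range.2 N.lt_succ_self)
      linarith
    · have h₁ : ℓ N q ≤ ℓ q q := by
        have hmax : ρ N q = ρ q q := by simp [hρ, max_eq_right h]
        have h₀ : 0 ≤ ρ q q := hτ0 _ _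
        have hNq : (N : ℝ) ≤ q := by exact_mod_cast h
        simp only [hℓ, hmax]
        have hσle : 2 * σ N 0 ≤ 2 * σ q 0 := by
          linarith [hσ.mono_left N.cast_nonneg hNq le_rfl]
        have hL : L (N + ρ q q) (2 * σ N 0) ≤ L (q + ρ q q) (2 * σ q 0) :=
          (hLr _ (by positivity) (by simpa using hσ0 N) (by simpa using hσ0 q) hσle).trans
            (hLl _ (by linarith [hσ0 q]) (mem_Ici.2 (by positivity)) (mem_Ici.2 (by positivity))
              (by linarith))
        gcongr
      have h₂ : (ℓ q q)⁻¹ * ℓ N q ≤ 1 := by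
        rw [inv_mul_le_iff₀ (hℓpos _ _), mul_one]
        exact h₁
      have h₃ := Finset.sum_nonneg fun k (_ : k ∈ Finset.range (N + 1)) => hsum0 k
      linarith

lemma GainWeights.nonneg {c M : ℕ → ℝ} {τ : ℕ → ℕ → ℝ} (W : GainWeights σ L c M τ) (N : ℕ) :
    0 ≤ M N :=
  le_trans (mul_nonneg (W.pos 0).le (by positivity)) (W.bound N 0)

lemma IsKInf.const_mul {a : ℝ → ℝ} (ha : IsKInf a) {k : ℝ} (hk : 0 < k) :
    IsKInf (fun s => k * a s) :=
  ⟨ha.1.const_smul k, fun _ hs _ ht h => mul_lt_mul_of_pos_left (ha.2.1 hs ht h) hk,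
    by simp [ha.2.2.1], fun s hs => mul_nonneg hk.le (ha.2.2.2.1 s hs),
    ha.2.2.2.2.const_mul_atTop hk⟩

/-- The supremum of the weighted cut-offs is of class `K∞`. -/
lemma exists_isKInf_le_of_cutoff_le {c : ℕ → ℝ} (hc : ∀ q, 0 < c q) (hc1 : ∀ q, c q ≤ 1) :
    ∃ a, IsKInf a ∧ ∀ s B, 0 ≤ s →
      (∀ q : ℕ, c q * max 0 (s - 1 / ((q : ℝ) + 1)) ≤ B) → a s ≤ B := by
  set u : ℕ → ℝ → ℝ := fun q s => c q * max 0 (s - 1 / ((q : ℝ) + 1)) with hu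
  have hu0 : ∀ q s, 0 ≤ u q s := fun q s => mul_nonneg (hc q).le (le_max_left _ _)
  have hus : ∀ q s, 0 ≤ s → u q s ≤ s := fun q s hs => by
    have h₁ : max 0 (s - 1 / ((q : ℝ) + 1)) ≤ s :=
      max_le hs (by linarith [show 0 ≤ 1 / ((q : ℝ) + 1) by positivity])
    calc u q s ≤ 1 * max 0 (s - 1 / ((q : ℝ) + 1)) :=
          mul_le_mul_of_nonneg_right (hc1 q) (le_max_left _ _)
      _ ≤ s := by rwa [one_mul]
  have hbdd : ∀ s, 0 ≤ s → BddAbove (range fun q => u q s) := fun s hs =>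
    ⟨s, by rintro _ ⟨q, rfl⟩; exact hus q s hs⟩
  set G : ℝ → ℝ := fun s => ⨆ q, u q s with hG
  have hG0 : G 0 = 0 := by
    have : ∀ q, u q 0 = 0 := fun q => le_antisymm (hus q 0 le_rfl) (hu0 q 0)
    simp [hG, this]
  have hle : ∀ s, 0 ≤ s → ∀ q, u q s ≤ G s := fun s hs q => le_ciSup (hbdd s hs) q
  have hpos : ∀ s, 0 < s → 0 < G s := fun s hs => by
    obtain ⟨q, hq⟩ := exists_nat_one_div_lt hs
    exact lt_of_lt_of_le (mul_pos (hc q) (lt_max_of_lt_right (by linarith))) (hle s hs.le q)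
  have hlip : ∀ s, 0 ≤ s → ∀ s', 0 ≤ s' → G s ≤ G s' + |s - s'| := fun s hs s' hs' => by
    refine ciSup_le fun q => ?_
    have h₁ : max 0 (s - 1 / ((q : ℝ) + 1)) ≤ max 0 (s' - 1 / ((q : ℝ) + 1)) + |s - s'| := by
      refine max_le (by positivity) ?_
      linarith [le_abs_self (s - s'), le_max_right 0 (s' - 1 / ((q : ℝ) + 1))]
    have h₂ := mul_le_mul_of_nonneg_left h₁ (hc q).le
    have h₃ := mul_le_mul_of_nonneg_right (hc1 q) (abs_nonneg (s - s'))
    have h₄ := hle s' hs' q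
    simp only [hu] at h₄ ⊢
    linarith
  refine ⟨G, ⟨?_, ?_, hG0, fun s hs => (hu0 0 s).trans (hle s hs 0), ?_⟩,
    fun s B _ h => ciSup_le h⟩
  · refine LipschitzOnWith.continuousOn (K := 1) (LipschitzOnWith.of_dist_le_mul ?_)
    intro s hs s' hs'
    rw [NNReal.coe_one, one_mul, Real.dist_eq, Real.dist_eq, abs_le]
    have h₁ := hlip s hs s' hs'
    have h₂ := hlip s' hs' s hs
    rw [abs_sub_comm] at h₂
    constructor <;> linarith
  · intro s hs s' hs' hss
    have hs0 : 0 ≤ s := hs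
    have hs0' : 0 < s' := hs0.trans_lt hss
    have h₁ : G s ≤ s / s' * G s' := by
      refine ciSup_le fun q => ?_
      have h₂ : max 0 (s - 1 / ((q : ℝ) + 1)) ≤
          s / s' * max 0 (s' - 1 / ((q : ℝ) + 1)) := by
        have hd0 : 0 ≤ s / s' := div_nonneg hs0 hs0'.le
        have hd1 : s / s' ≤ 1 := (div_le_one hs0').2 hss.le
        refine max_le (mul_nonneg hd0 (le_max_left _ _)) ?_
        refine le_trans ?_ (mul_le_mul_of_nonneg_left (le_max_right _ _) hd0)
        rw [mul_sub, div_mul_cancel₀ _ hs0'.ne']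
        have hp : 0 ≤ 1 / ((q : ℝ) + 1) := by positivity
        linarith [mul_le_mul_of_nonneg_right hd1 hp]
      calc u q s ≤ c q * (s / s' * max 0 (s' - 1 / ((q : ℝ) + 1))) :=
            mul_le_mul_of_nonneg_left h₂ (hc q).le
        _ = s / s' * u q s' := by simp only [hu]; ring
        _ ≤ s / s' * G s' :=
            mul_le_mul_of_nonneg_left (hle _ hs0'.le _) (div_nonneg hs0 hs0'.le)
    have h₃ : s / s' < 1 := (div_lt_one hs0').2 hss
    nlinarith [hpos s' hs0']
  · have h₁ : Tendsto (fun s : ℝ => c 0 * (s - 1)) atTop atTop :=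
      (tendsto_atTop_add_const_right _ (-1) tendsto_id).const_mul_atTop (hc 0)
    refine tendsto_atTop_mono' _ ?_ h₁
    filter_upwards [eventually_ge_atTop 0] with s hs
    refine le_trans ?_ (hle s hs 0)
    simp only [hu, CharP.cast_eq_zero, zero_add, div_one]
    exact mul_le_mul_of_nonneg_left (le_max_right _ _) (hc 0).le

/-- A product of a `KL` function with a locally bounded factor has a `K∞` majorant. -/
lemma exists_isKInf_majorant (hσ : IsKL σ) {M : ℕ → ℝ} (hM : Monotone M) (hM0 : ∀ N, 0 ≤ M N) :
    ∃ a, IsKInf a ∧ ∀ s, 0 ≤ s → M ⌈s⌉₊ * σ s 0 ≤ a s := by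
  set m : ℝ → ℝ := fun s => M ⌈s⌉₊ with hm
  have hmono : Monotone m := fun s s' h => hM (Nat.ceil_mono h)
  have hintegral : ∀ a b, IntervalIntegrable m volume a b := fun a b => hmono.intervalIntegrable
  set K : ℝ → ℝ := fun s => ∫ u in s..(s + 1), m u with hK
  have hKc : Continuous K := by
    have h₁ : Continuous fun s => ∫ u in (0 : ℝ)..s, m u :=
      intervalIntegral.continuous_primitive hintegral 0
    have h₂ : K = fun s => (∫ u in (0 : ℝ)..(s + 1), m u) - ∫ u in (0 : ℝ)..s, m u :=
      funext fun s =>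
        (intervalIntegral.integral_interval_sub_left (hintegral _ _) (hintegral _ _)).symm
    rw [h₂]
    exact (h₁.comp (by fun_prop : Continuous fun s : ℝ => s + 1)).sub h₁
  have hKle : ∀ s, m s ≤ K s := fun s => by
    have h₁ := intervalIntegral.integral_mono_on (a := s) (b := s + 1) (by linarith)
      (intervalIntegrable_const (c := m s)) (hintegral _ _) fun u hu => hmono hu.1
    simpa using h₁
  have hKmono : Monotone K := fun s s' h => by
    have h₁ : ∀ s, K s = ∫ u in (0 : ℝ)..1, m (u + s) := fun s => by
      rw [intervalIntegral.integral_comp_add_right, zero_add, add_comm 1 s]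
    rw [h₁ s, h₁ s']
    exact intervalIntegral.integral_mono_on zero_le_one
      (Monotone.intervalIntegrable fun a b hab => hmono (by linarith))
      (Monotone.intervalIntegrable fun a b hab => hmono (by linarith))
      fun u _ => hmono (by linarith)
  have hK0 : ∀ s, 0 ≤ K s := fun s => (hM0 _).trans (hKle s)
  have hσ0 : ∀ s, 0 ≤ s → 0 ≤ σ s 0 := fun s hs => hσ.2.1 s 0 hs le_rfl
  have hσc : ContinuousOn (fun s => σ s 0) (Ici 0) :=
    hσ.1.comp (f := fun s : ℝ => (s, (0 : ℝ))) (by fun_prop) fun s hs => ⟨hs, mem_Ici.2 le_rfl⟩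
  refine ⟨fun s => K s * σ s 0 + s, ⟨(hKc.continuousOn.mul hσc).add continuousOn_id, ?_, ?_,
    fun s hs => add_nonneg (mul_nonneg (hK0 s) (hσ0 s hs)) hs, ?_⟩, fun s hs => ?_⟩
  · intro s hs s' hs' h
    have h₁ := mul_le_mul (hKmono h.le) (hσ.mono_left hs h.le le_rfl) (hσ0 s hs) (hK0 s')
    simp only
    linarith
  · simp [(hσ.2.2.1 0 le_rfl).2]
  · refine tendsto_atTop_mono' _ ?_ tendsto_id
    filter_upwards [eventually_ge_atTop 0] with s hs
    have := mul_nonneg (hK0 s) (hσ0 s hs)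
    simpa using this
  · have := mul_le_mul_of_nonneg_right (hKle s) (hσ0 s hs)
    simp only [hm] at this
    linarith

end Weights

/-! ### The gain functional -/

/-- The weighted, exponentially discounted cut-off gains of all trajectories starting from
`(t₀, x₀)`. -/
def gainSet (n l : ℕ) (r : ℝ) (D : Set (Euc l)) (f : ℝ → (ℝ → Euc n) → Euc l → Euc n)
    (c : ℕ → ℝ) (t₀ : ℝ) (x₀ : ℝ → Euc n) : Set ℝ :=
  {v | ∃ (q : ℕ) (d : ℝ → Euc l) (x : ℝ → Euc n) (t : ℝ), IsTraj n l r D f t₀ x₀ d x ∧ t₀ ≤ t ∧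
    v = c q * (Real.exp (2 * (t - t₀)) *
      max 0 (histNorm n r (fun θ => x (t + θ)) - 1 / ((q : ℝ) + 1)))}

/-- The supremum of the gains of all trajectories starting from `(t₀, x₀)`. -/
def supGain (n l : ℕ) (r : ℝ) (D : Set (Euc l)) (f : ℝ → (ℝ → Euc n) → Euc l → Euc n)
    (c : ℕ → ℝ) (t₀ : ℝ) (x₀ : ℝ → Euc n) : ℝ :=
  sSup (gainSet n l r D f c t₀ x₀)

section Gain

variable {n l : ℕ} {r : ℝ} {D : Set (Euc l)} {f : ℝ → (ℝ → Euc n) → Euc l → Euc n}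
  {σ L : ℝ → ℝ → ℝ} {c M : ℕ → ℝ} {τ : ℕ → ℕ → ℝ} {t₀ t₁ : ℝ} {x₀ y₀ x y : ℝ → Euc n}
  {d d' : ℝ → Euc l}

lemma gainSet_nonempty (S : StableSystem n l r D f σ L) (ht₀ : 0 ≤ t₀)
    (hx₀ : ContinuousOn x₀ (Icc (-r) 0)) : (gainSet n l r D f c t₀ x₀).Nonempty := by
  obtain ⟨v, hv⟩ := S.nonempty
  obtain ⟨x, hx⟩ := S.exists_traj ht₀ hx₀ (MD.const hv)
  exact ⟨_, 0, _, x, t₀, hx, le_rfl, rfl⟩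

/-- A gain either vanishes or is attained before the horizon. -/
lemma StableSystem.cutoff_eq_zero (S : StableSystem n l r D f σ L) (W : GainWeights σ L c M τ)
    (ht₀ : 0 ≤ t₀) {N q : ℕ} (hN : histNorm n r x₀ ≤ N) (hx : IsTraj n l r D f t₀ x₀ d x)
    (ht : τ N q ≤ t₁ - t₀) :
    max 0 (histNorm n r (fun θ => x (t₁ + θ)) - 1 / ((q : ℝ) + 1)) = 0 := by
  refine max_eq_left ?_
  have h₀ := W.horizon_nonneg N q
  have h₁ := S.hist_le ht₀ hx hN (t₁ := t₁) (by linarith)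
  have h₂ := S.kl.anti_right N.cast_nonneg h₀ ht
  linarith [W.decay N q]

lemma GainWeights.gain_le (W : GainWeights σ L c M τ) (S : StableSystem n l r D f σ L)
    {N q : ℕ} {t : ℝ} (h : t ≤ τ N q) : c q * Real.exp (2 * t) ≤ M N := by
  have h₀ := W.horizon_nonneg N q
  have h₁ : Real.exp (2 * t) ≤ Real.exp (2 * τ N q) := Real.exp_le_exp.2 (by linarith)
  have h₂ : 1 ≤ Real.exp (L (N + τ N q) (2 * σ N 0) * τ N q) :=
    Real.one_le_exp (mul_nonneg (S.lip_nonneg _ _ (by positivity)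
      (by linarith [S.kl.2.1 N 0 N.cast_nonneg le_rfl])) h₀)
  refine le_trans (mul_le_mul_of_nonneg_left ?_ (W.pos q).le) (W.bound N q)
  nlinarith [Real.exp_pos (2 * τ N q)]

lemma StableSystem.gain_le (S : StableSystem n l r D f σ L) (W : GainWeights σ L c M τ)
    (ht₀ : 0 ≤ t₀) {N : ℕ} (hN : histNorm n r x₀ ≤ N) {v : ℝ}
    (hv : v ∈ gainSet n l r D f c t₀ x₀) : v ≤ M N * σ (histNorm n r x₀) 0 := by
  obtain ⟨q, d, x, t, hx, ht, rfl⟩ := hv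
  have hσ0 : 0 ≤ σ (histNorm n r x₀) 0 := S.kl.2.1 _ _ (histNorm_nonneg _) le_rfl
  rcases le_total (τ N q) (t - t₀) with h | h
  · rw [S.cutoff_eq_zero W ht₀ hN hx h, mul_zero, mul_zero]
    exact mul_nonneg (W.nonneg N) hσ0
  · rw [← mul_assoc]
    refine mul_le_mul (W.gain_le S h) (max_le hσ0 ?_) (le_max_left _ _) (W.nonneg N)
    have := S.hist_le_zero ht₀ hx le_rfl ht
    linarith [show 0 ≤ 1 / ((q : ℝ) + 1) by positivity]

lemma StableSystem.bddAbove_gainSet (S : StableSystem n l r D f σ L)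
    (W : GainWeights σ L c M τ) (ht₀ : 0 ≤ t₀) (x₀ : ℝ → Euc n) :
    BddAbove (gainSet n l r D f c t₀ x₀) :=
  ⟨_, fun _ hv => S.gain_le W ht₀ (Nat.le_ceil (histNorm n r x₀)) hv⟩

lemma StableSystem.supGain_le (S : StableSystem n l r D f σ L) (W : GainWeights σ L c M τ)
    (ht₀ : 0 ≤ t₀) (hx₀ : ContinuousOn x₀ (Icc (-r) 0)) {N : ℕ} (hN : histNorm n r x₀ ≤ N) :
    supGain n l r D f c t₀ x₀ ≤ M N * σ (histNorm n r x₀) 0 :=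
  csSup_le (gainSet_nonempty S ht₀ hx₀) fun _ hv => S.gain_le W ht₀ hN hv

lemma StableSystem.le_supGain (S : StableSystem n l r D f σ L) (W : GainWeights σ L c M τ)
    (ht₀ : 0 ≤ t₀) (hx : IsTraj n l r D f t₀ x₀ d x) (ht : t₀ ≤ t₁) (q : ℕ) :
    c q * (Real.exp (2 * (t₁ - t₀)) *
      max 0 (histNorm n r (fun θ => x (t₁ + θ)) - 1 / ((q : ℝ) + 1))) ≤
      supGain n l r D f c t₀ x₀ :=
  le_csSup (S.bddAbove_gainSet W ht₀ x₀) ⟨q, d, x, t₁, hx, ht, rfl⟩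

lemma StableSystem.cutoff_le_supGain (S : StableSystem n l r D f σ L)
    (W : GainWeights σ L c M τ) (ht₀ : 0 ≤ t₀) (hx₀ : ContinuousOn x₀ (Icc (-r) 0)) (q : ℕ) :
    c q * max 0 (histNorm n r x₀ - 1 / ((q : ℝ) + 1)) ≤ supGain n l r D f c t₀ x₀ := by
  obtain ⟨v, hv⟩ := S.nonempty
  obtain ⟨x, hx⟩ := S.exists_traj ht₀ hx₀ (MD.const hv)
  have := S.le_supGain W ht₀ hx le_rfl q
  rwa [hx.histNorm_init, sub_self, mul_zero, Real.exp_zero, one_mul] at this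

lemma StableSystem.supGain_nonneg (S : StableSystem n l r D f σ L)
    (W : GainWeights σ L c M τ) (ht₀ : 0 ≤ t₀) (hx₀ : ContinuousOn x₀ (Icc (-r) 0)) :
    0 ≤ supGain n l r D f c t₀ x₀ :=
  le_trans (mul_nonneg (W.pos 0).le (le_max_left _ _)) (S.cutoff_le_supGain W ht₀ hx₀ 0)

/-- The gain functional is Lipschitz on bounded sets. -/
lemma StableSystem.supGain_le_add (S : StableSystem n l r D f σ L)
    (W : GainWeights σ L c M τ) (ht₀ : 0 ≤ t₀) (hx₀ : ContinuousOn x₀ (Icc (-r) 0))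
    (hy₀ : ContinuousOn y₀ (Icc (-r) 0)) {N : ℕ} (htN : t₀ ≤ N) (hxN : histNorm n r x₀ ≤ N)
    (hyN : histNorm n r y₀ ≤ N) :
    supGain n l r D f c t₀ x₀ ≤ supGain n l r D f c t₀ y₀ + M N * histNorm n r (x₀ - y₀) := by
  have hr := S.delay_nonneg
  refine csSup_le (gainSet_nonempty S ht₀ hx₀) ?_
  rintro _ ⟨q, d, x, t, hx, ht, rfl⟩
  rcases le_total (τ N q) (t - t₀) with h | h
  · rw [S.cutoff_eq_zero W ht₀ hxN hx h, mul_zero, mul_zero]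
    exact add_nonneg (S.supGain_nonneg W ht₀ hy₀) (mul_nonneg (W.nonneg N) (histNorm_nonneg _))
  obtain ⟨y, hy⟩ := S.exists_traj ht₀ hy₀ hx.1
  set m := histNorm n r (x₀ - y₀) with hm
  have hm0 : 0 ≤ m := histNorm_nonneg _
  have hσ0 : 0 ≤ σ N 0 := S.kl.2.1 N 0 N.cast_nonneg le_rfl
  have h₁ := S.le_supGain W ht₀ hy ht q
  have h₂ := S.histNorm_sub_le ht₀ hx hy hxN hyN ht
  have h₃ := histNorm_le_add hr (hx.continuousOn_hist ht) (hy.continuousOn_hist ht)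
  have hL : L t (2 * σ N 0) * (t - t₀) ≤ L (N + τ N q) (2 * σ N 0) * τ N q := by
    refine mul_le_mul ?_ h (by linarith)
      (S.lip_nonneg _ _ (add_nonneg N.cast_nonneg (W.horizon_nonneg N q)) (by linarith))
    exact S.lip_mono_left _ (by linarith) (ht₀.trans ht)
      (add_nonneg N.cast_nonneg (W.horizon_nonneg N q)) (by linarith)
  have h₄ : max 0 (histNorm n r (fun θ => x (t + θ)) - 1 / ((q : ℝ) + 1)) ≤
      max 0 (histNorm n r (fun θ => y (t + θ)) - 1 / ((q : ℝ) + 1)) +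
        Real.exp (L (N + τ N q) (2 * σ N 0) * τ N q) * m := by
    have h₅ : Real.exp (L t (2 * σ N 0) * (t - t₀)) * m ≤
        Real.exp (L (N + τ N q) (2 * σ N 0) * τ N q) * m := by gcongr
    refine max_le (by positivity) ?_
    linarith [le_max_right 0 (histNorm n r (fun θ => y (t + θ)) - 1 / ((q : ℝ) + 1))]
  have hW := W.bound N q
  calc c q * (Real.exp (2 * (t - t₀)) *
        max 0 (histNorm n r (fun θ => x (t + θ)) - 1 / ((q : ℝ) + 1)))
      ≤ c q * (Real.exp (2 * (t - t₀)) *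
        (max 0 (histNorm n r (fun θ => y (t + θ)) - 1 / ((q : ℝ) + 1)) +
        Real.exp (L (N + τ N q) (2 * σ N 0) * τ N q) * m)) := by
        have := (W.pos q).le
        gcongr
    _ = c q * (Real.exp (2 * (t - t₀)) *
        max 0 (histNorm n r (fun θ => y (t + θ)) - 1 / ((q : ℝ) + 1))) +
        c q * (Real.exp (2 * (t - t₀)) * Real.exp (L (N + τ N q) (2 * σ N 0) * τ N q)) * m := by
        ring
    _ ≤ supGain n l r D f c t₀ y₀ +
        c q * (Real.exp (2 * τ N q) * Real.exp (L (N + τ N q) (2 * σ N 0) * τ N q)) * m := by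
        have := (W.pos q).le
        gcongr
    _ ≤ supGain n l r D f c t₀ y₀ + M N * m := by gcongr

/-- Exponential decay of the gain functional along trajectories. -/
lemma StableSystem.supGain_hist_le (S : StableSystem n l r D f σ L)
    (W : GainWeights σ L c M τ) (ht₀ : 0 ≤ t₀) (hx : IsTraj n l r D f t₀ x₀ d x)
    (ht : t₀ ≤ t₁) :
    supGain n l r D f c t₁ (fun θ => x (t₁ + θ)) ≤
      Real.exp (-(2 * (t₁ - t₀))) * supGain n l r D f c t₀ x₀ := by
  refine csSup_le (gainSet_nonempty S (ht₀.trans ht) (hx.continuousOn_hist ht)) ?_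
  rintro _ ⟨q, d', y, t, hy, htt, rfl⟩
  have h₁ := S.le_supGain W ht₀ (S.concat ht₀ ht hx hy) (ht.trans htt) q
  have h₂ : histNorm n r (fun θ => if t + θ < t₁ then x (t + θ) else y (t + θ)) =
      histNorm n r (fun θ => y (t + θ)) := by
    refine histNorm_congr fun θ hθ => ?_
    split_ifs with h
    · have := hy.2.2 (t + θ - t₁) ⟨by linarith [hθ.1], by linarith⟩
      simp only [add_sub_cancel] at this
      exact this.symm
    · rfl
  rw [h₂] at h₁
  rw [Real.exp_neg, ← div_eq_inv_mul, le_div_iff₀ (Real.exp_pos _)]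
  refine le_trans (le_of_eq ?_) h₁
  have h₃ : Real.exp (2 * (t - t₀)) = Real.exp (2 * (t - t₁)) * Real.exp (2 * (t₁ - t₀)) := by
    rw [← Real.exp_add]
    congr 1
    ring
  rw [h₃]
  ring

/-- One-sided comparison of the gain functional at two close times. -/
lemma StableSystem.supGain_le_exp_mul (S : StableSystem n l r D f σ L)
    (W : GainWeights σ L c M τ) (ht₀ : 0 ≤ t₀) (hx₀ : ContinuousOn x₀ (Icc (-r) 0)) {h ω : ℝ}
    {N : ℕ} (hh : 0 ≤ h) (htN : t₀ + h ≤ N) (hN : histNorm n r x₀ + ω ≤ N)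
    (hω : ∀ h' d x, 0 ≤ h' → h' ≤ h → IsTraj n l r D f t₀ x₀ d x →
      histNorm n r ((fun θ => x (t₀ + h' + θ)) - x₀) ≤ ω) :
    supGain n l r D f c t₀ x₀ ≤
      Real.exp (2 * h) * (supGain n l r D f c (t₀ + h) x₀ + (M N + 1) * ω) := by
  have hr := S.delay_nonneg
  refine csSup_le (gainSet_nonempty S ht₀ hx₀) ?_
  rintro _ ⟨q, d, x, t, hx, ht, rfl⟩
  have hω0 : 0 ≤ ω := (histNorm_nonneg _).trans (hω 0 d x le_rfl hh hx)
  have hM := W.nonneg N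
  have hth : 0 ≤ t₀ + h := by linarith
  have hnear : ∀ h', 0 ≤ h' → h' ≤ h →
      histNorm n r (fun θ => x (t₀ + h' + θ)) ≤ histNorm n r x₀ + ω := by
    intro h' h₀ h₁
    have := histNorm_le_add hr (hx.continuousOn_hist (t := t₀ + h') (by linarith)) hx₀
    linarith [hω h' d x h₀ h₁ hx]
  rcases le_total (t₀ + h) t with hcase | hcase
  · have h₁ := S.le_supGain W hth (hx.restart (t₁ := t₀ + h) (by linarith)) hcase q
    have h₂ := S.supGain_le_add W hth (hx.continuousOn_hist (t := t₀ + h) (by linarith)) hx₀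
      htN ((hnear h hh le_rfl).trans hN) (by linarith)
    have h₃ : M N * histNorm n r ((fun θ => x (t₀ + h + θ)) - x₀) ≤ (M N + 1) * ω := by
      have h₄ := mul_le_mul_of_nonneg_left (hω h d x hh le_rfl hx) hM
      linarith
    have h₄ : Real.exp (2 * (t - t₀)) = Real.exp (2 * h) * Real.exp (2 * (t - (t₀ + h))) := by
      rw [← Real.exp_add]
      congr 1
      ring
    rw [h₄, mul_assoc, mul_left_comm]
    exact mul_le_mul_of_nonneg_left (by linarith) (Real.exp_pos _).le
  · have h₁ := hnear (t - t₀) (by linarith) (by linarith)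
    rw [add_sub_cancel] at h₁
    have h₂ := S.cutoff_le_supGain W hth hx₀ q
    have h₃ : max 0 (histNorm n r (fun θ => x (t + θ)) - 1 / ((q : ℝ) + 1)) ≤
        max 0 (histNorm n r x₀ - 1 / ((q : ℝ) + 1)) + ω := by
      refine max_le (by positivity) ?_
      linarith [le_max_right 0 (histNorm n r x₀ - 1 / ((q : ℝ) + 1))]
    have h₄ : Real.exp (2 * (t - t₀)) ≤ Real.exp (2 * h) := Real.exp_le_exp.2 (by linarith)
    have hc := (W.pos q).le
    rw [mul_left_comm]
    refine mul_le_mul h₄ ?_ (mul_nonneg hc (le_max_left _ _)) (Real.exp_pos _).le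
    have h₅ := mul_le_mul_of_nonneg_left h₃ hc
    have h₆ := mul_le_mul_of_nonneg_right (W.le_one q) hω0
    have h₇ := mul_nonneg hM hω0
    linarith

/-- Continuity of the gain functional in time, locally uniformly. -/
lemma StableSystem.exists_abs_supGain_sub_lt (S : StableSystem n l r D f σ L)
    (W : GainWeights σ L c M τ) (hx₀ : ContinuousOn x₀ (Icc (-r) 0)) (N : ℕ) {ε : ℝ}
    (hε : 0 < ε) :
    ∃ δ > 0, ∀ t h : ℝ, 0 ≤ t → t ≤ N → 0 ≤ h → h < δ →
      |supGain n l r D f c (t + h) x₀ - supGain n l r D f c t x₀| < ε := by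
  have hr := S.delay_nonneg
  obtain ⟨P, hP⟩ := exists_nat_ge (N + 1 + histNorm n r x₀ + 1)
  have hx0 : 0 ≤ histNorm n r x₀ := histNorm_nonneg _
  have hN0 : (0 : ℝ) ≤ N := N.cast_nonneg
  have hM := W.nonneg P
  set B := M P * σ (histNorm n r x₀) 0 with hB
  have hB0 : 0 ≤ B := mul_nonneg hM (S.kl.2.1 _ _ hx0 le_rfl)
  set ω := min 1 (ε / (8 * (M P + 1))) with hω
  have hω0 : 0 < ω := by positivity
  have hωε : (M P + 1) * ω ≤ ε / 8 := by
    have : ω ≤ ε / (8 * (M P + 1)) := min_le_right _ _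
    rw [le_div_iff₀ (by positivity)] at this
    linarith
  obtain ⟨δ₁, hδ₁, h₁⟩ := S.exists_histNorm_sub_lt N hx₀ hω0
  have hexp : ∀ᶠ h in nhds (0 : ℝ), Real.exp (2 * h) * (B + ε / 8) < B + ε / 4 := by
    have hc : ContinuousAt (fun h : ℝ => Real.exp (2 * h) * (B + ε / 8)) 0 := by fun_prop
    refine hc.eventually_lt continuousAt_const ?_
    simp
    linarith
  obtain ⟨δ₂, hδ₂, h₂⟩ := Metric.eventually_nhds_iff.1 hexp
  refine ⟨min 1 (min δ₁ δ₂), by positivity, fun t h ht htN hh hhδ => ?_⟩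
  simp only [lt_min_iff] at hhδ
  obtain ⟨hh1, hhδ₁, hhδ₂⟩ := hhδ
  have hω1 : ω ≤ 1 := min_le_left _ _
  have lower := S.supGain_le_exp_mul W ht hx₀ (N := P) (ω := ω) hh (by linarith) (by linarith)
    fun h' d x h₀ h' hx => (h₁ t _ d x ht htN h₀ (by linarith) hx).le
  obtain ⟨v, hv⟩ := S.nonempty
  obtain ⟨x, hx⟩ := S.exists_traj ht hx₀ (MD.const hv)
  have hxh := hx.continuousOn_hist (t := t + h) (by linarith)
  have hclose := h₁ t h _ x ht htN hh hhδ₁ hx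
  have hnorm := histNorm_le_add hr hxh hx₀
  have u₁ := S.supGain_hist_le W ht hx (t₁ := t + h) (by linarith)
  have u₂ := S.supGain_le_add W (t₀ := t + h) (by linarith) hx₀ hxh (N := P) (by linarith)
    (by linarith) (by linarith)
  rw [histNorm_sub_comm] at u₂
  have hg := S.supGain_nonneg W ht hx₀
  have u₃ : Real.exp (-(2 * (t + h - t))) * supGain n l r D f c t x₀ ≤
      supGain n l r D f c t x₀ :=
    mul_le_of_le_one_left hg (Real.exp_le_one_iff.2 (by linarith))
  have u₄ : M P * histNorm n r ((fun θ => x (t + h + θ)) - x₀) ≤ (M P + 1) * ω := by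
    have := mul_le_mul_of_nonneg_left hclose.le hM
    linarith
  have h₃ := h₂ (y := h) (by rw [Real.dist_eq, sub_zero, abs_of_nonneg hh]; exact hhδ₂)
  have hbound := S.supGain_le W (t₀ := t + h) (by linarith) hx₀ (N := P) (by linarith)
  set G := supGain n l r D f c (t + h) x₀
  have hG0 : 0 ≤ G := S.supGain_nonneg W (by linarith) hx₀
  have hE : 1 ≤ Real.exp (2 * h) := Real.one_le_exp (by linarith)
  have l₁ : Real.exp (2 * h) * (G + (M P + 1) * ω) ≤ G + ε / 4 := by
    have l₂ : Real.exp (2 * h) * (G + (M P + 1) * ω) ≤ Real.exp (2 * h) * (G + ε / 8) := by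
      gcongr
    nlinarith
  rw [abs_lt]
  constructor <;> linarith

/-- The gain functional of a periodic system is periodic. -/
lemma supGain_add_period {T : ℝ} (hT : 0 ≤ T)
    (hf : ∀ t x d, 0 ≤ t → ContinuousOn x (Icc (-r) 0) → d ∈ D → f (t + T) x d = f t x d)
    (ht₀ : 0 ≤ t₀) : supGain n l r D f c (t₀ + T) x₀ = supGain n l r D f c t₀ x₀ := by
  unfold supGain
  congr 1
  ext v
  constructor
  · rintro ⟨q, d, x, t, hx, ht, rfl⟩
    refine ⟨q, _, _, t - T, hx.advance hT hf ht₀, by linarith, ?_⟩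
    have h₁ : ∀ θ, t - T + θ + T = t + θ := fun θ => by ring
    simp only [h₁]
    congr 4
    ring
  · rintro ⟨q, d, x, t, hx, ht, rfl⟩
    refine ⟨q, _, _, t + T, hx.delay hf ht₀, by linarith, ?_⟩
    have h₁ : ∀ θ, t + T + θ - T = t + θ := fun θ => by ring
    simp only [h₁]
    congr 4
    ring

end Gain

/-! ### A weight with square-root growth after given times -/

/-- A weight which vanishes on `A`, grows like a square root to the right of the points of `A`,
and decreases at most with unit speed. -/
def dipWeight (A : Set ℝ) (t : ℝ) : ℝ :=
  sInf (insert 1 ((fun a => √(t - a) + max (a - t) 0) '' A))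

section DipWeight

variable {A : Set ℝ} {t h : ℝ}

lemma le_dipWeight {b : ℝ} (hb : b ≤ 1) (h : ∀ a ∈ A, b ≤ √(t - a) + max (a - t) 0) :
    b ≤ dipWeight A t := by
  refine le_csInf (insert_nonempty _ _) ?_
  rintro _ (rfl | ⟨a, ha, rfl⟩)
  exacts [hb, h a ha]

lemma bddBelow_dipWeight (A : Set ℝ) (t : ℝ) :
    BddBelow (insert 1 ((fun a => √(t - a) + max (a - t) 0) '' A)) := by
  refine ⟨0, ?_⟩
  rintro _ (rfl | ⟨a, -, rfl⟩)
  · exact zero_le_one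
  · positivity

lemma dipWeight_le_one (A : Set ℝ) (t : ℝ) : dipWeight A t ≤ 1 :=
  csInf_le (bddBelow_dipWeight A t) (mem_insert _ _)

lemma dipWeight_le {a : ℝ} (ha : a ∈ A) : dipWeight A t ≤ √(t - a) + max (a - t) 0 :=
  csInf_le (bddBelow_dipWeight A t) (mem_insert_of_mem _ ⟨a, ha, rfl⟩)

lemma dipWeight_nonneg (A : Set ℝ) (t : ℝ) : 0 ≤ dipWeight A t :=
  le_dipWeight zero_le_one fun _ _ => by positivity

lemma dipWeight_eq_zero (ht : t ∈ A) : dipWeight A t = 0 :=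
  le_antisymm ((dipWeight_le ht).trans (by simp)) (dipWeight_nonneg A t)

lemma dipWeight_sub_le (A : Set ℝ) (t : ℝ) (hh : 0 ≤ h) :
    dipWeight A t - h ≤ dipWeight A (t + h) := by
  refine le_dipWeight (by linarith [dipWeight_le_one A t]) fun a ha => ?_
  have h₁ : √(t - a) ≤ √(t + h - a) := Real.sqrt_le_sqrt (by linarith)
  have h₂ : max (a - t) 0 ≤ max (a - (t + h)) 0 + h :=
    max_le (by linarith [le_max_left (a - (t + h)) 0]) (by positivity)
  linarith [dipWeight_le (t := t) ha]

lemma dipWeight_add_le (A : Set ℝ) (t : ℝ) (hh : 0 ≤ h) :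
    dipWeight A (t + h) ≤ dipWeight A t + √h := by
  rw [← sub_le_iff_le_add]
  refine le_dipWeight (by linarith [dipWeight_le_one A (t + h), Real.sqrt_nonneg h])
    fun a ha => ?_
  have h₁ : √(t + h - a) ≤ √(t - a) + √h := by
    refine Real.sqrt_le_iff.2 ⟨by positivity, ?_⟩
    have h₂ := Real.sq_sqrt hh
    rcases le_total 0 (t - a) with h₃ | h₃
    · have h₄ := Real.sq_sqrt h₃
      nlinarith [mul_nonneg (Real.sqrt_nonneg (t - a)) (Real.sqrt_nonneg h)]
    · rw [Real.sqrt_eq_zero_of_nonpos h₃]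
      linarith
  have h₂ : max (a - (t + h)) 0 ≤ max (a - t) 0 := max_le_max_right _ (by linarith)
  linarith [dipWeight_le (t := t + h) ha]

lemma abs_dipWeight_sub_le (A : Set ℝ) (t t' : ℝ) :
    |dipWeight A t' - dipWeight A t| ≤ √|t' - t| + |t' - t| := by
  wlog hle : t ≤ t' generalizing t t'
  · rw [abs_sub_comm, abs_sub_comm t' t]
    exact this t' t (le_of_not_ge hle)
  obtain ⟨h, rfl⟩ := exists_add_of_le hle
  have hh : 0 ≤ h := by linarith
  have h₁ := dipWeight_sub_le A t hh
  have h₂ := dipWeight_add_le A t hh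
  rw [add_sub_cancel_left, abs_of_nonneg hh, abs_le]
  constructor <;> linarith [Real.sqrt_nonneg h]

lemma exists_sqrt_le_dipWeight (hA : ∀ C : ℝ, (A ∩ Icc 0 C).Finite) (ht : 0 ≤ t) :
    ∃ δ > 0, ∀ h, 0 ≤ h → h < δ → t ∈ A → √h ≤ dipWeight A (t + h) := by
  have hfin : ((A ∩ Icc 0 (t + 1)) \ {t}).Finite := (hA (t + 1)).subset sdiff_subset
  obtain ⟨ε, hε, hball⟩ := Metric.isOpen_iff.1 hfin.isClosed.isOpen_compl t (by simp)
  have hgap : ∀ b ∈ A, t < b → min ε 1 ≤ b - t := by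
    intro b hb htb
    by_contra! hlt
    obtain ⟨h₁, h₂⟩ := lt_min_iff.1 hlt
    refine hball (show b ∈ Metric.ball t ε from ?_)
      ⟨⟨hb, by linarith, by linarith⟩, fun h => htb.ne' h⟩
    rwa [Metric.mem_ball, Real.dist_eq, abs_of_pos (by linarith)]
  set ρ := min ε 1 with hρ
  have hρ0 : 0 < ρ := by positivity
  refine ⟨(ρ / 2) ^ 2, by positivity, fun h hh hhδ _ => ?_⟩
  have hρ1 : ρ ≤ 1 := min_le_right _ _
  have h₁ : √h ≤ ρ / 2 := Real.sqrt_le_iff.2 ⟨by positivity, hhδ.le⟩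
  have h₂ : h ≤ √h := by nlinarith [Real.sq_sqrt hh, Real.sqrt_nonneg h]
  refine le_dipWeight (by linarith) fun b hb => ?_
  rcases le_or_gt b t with hbt | hbt
  · have h₃ : √h ≤ √(t + h - b) := Real.sqrt_le_sqrt (by linarith)
    linarith [le_max_right (b - (t + h)) 0]
  · have h₃ := hgap b hb hbt
    linarith [le_max_left (b - (t + h)) 0, Real.sqrt_nonneg (t + h - b)]

lemma dipWeight_add_period {T : ℝ} (hT : 0 ≤ T) (hA0 : ∀ a ∈ A, 0 ≤ a)
    (hA : ∀ a, 0 ≤ a → (a + T ∈ A ↔ a ∈ A)) (ht : 0 ≤ t) :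
    dipWeight A (t + T + T) = dipWeight A (t + T) := by
  refine le_antisymm (le_dipWeight (dipWeight_le_one _ _) fun a ha => ?_)
    (le_dipWeight (dipWeight_le_one _ _) fun a ha => ?_)
  · have h₁ := dipWeight_le (t := t + T + T) ((hA a (hA0 a ha)).2 ha)
    rwa [add_sub_add_right_eq_sub, add_sub_add_right_eq_sub] at h₁
  · rcases le_total T a with h | h
    · have h₁ : a - T ∈ A := (hA (a - T) (by linarith)).1 (by simpa using ha)
      have h₂ := dipWeight_le (t := t + T) h₁
      have h₃ : t + T - (a - T) = t + T + T - a := by ring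
      have h₄ : a - T - (t + T) = a - (t + T + T) := by ring
      rwa [h₃, h₄] at h₂
    · refine (dipWeight_le (t := t + T) ha).trans ?_
      rw [max_eq_right (by linarith), max_eq_right (by linarith)]
      gcongr
      linarith

end DipWeight

/-! ### Times of irregularity -/

/-- Joint right-continuity in time and continuity in the state of `f` at `(t, x, d)`, for a
frozen disturbance. -/
def RightCont (n l : ℕ) (r : ℝ) (f : ℝ → (ℝ → Euc n) → Euc l → Euc n) (t : ℝ) (x : ℝ → Euc n)
    (d : Euc l) : Prop :=
  ∀ ε > 0, ∃ δ > 0, ∀ t' x', t ≤ t' → t' - t < δ → ContinuousOn x' (Icc (-r) 0) →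
    histNorm n r (x' - x) < δ → ‖f t' x' d - f t x d‖ < ε

/-- The times at which joint right-continuity of `f` fails. -/
def irregularTimes (n l : ℕ) (r : ℝ) (D : Set (Euc l)) (f : ℝ → (ℝ → Euc n) → Euc l → Euc n) :
    Set ℝ :=
  {t | 0 ≤ t ∧ ∃ x d, ContinuousOn x (Icc (-r) 0) ∧ d ∈ D ∧ ¬ RightCont n l r f t x d}

section Irregular

variable {n l : ℕ} {r : ℝ} {D : Set (Euc l)} {f : ℝ → (ℝ → Euc n) → Euc l → Euc n}
  {σ L : ℝ → ℝ → ℝ} {t T : ℝ} {x : ℝ → Euc n} {d : Euc l}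

lemma H3.finite_irregularTimes (h3 : H3 n l r D f) (C : ℝ) :
    (irregularTimes n l r D f ∩ Icc 0 C).Finite := by
  obtain ⟨A, hA, hcont, -⟩ := h3
  refine (hA C).subset ?_
  rintro t ⟨⟨ht, x, d, hx, hd, hirr⟩, htC⟩
  refine ⟨?_, htC⟩
  by_contra htA
  refine hirr fun ε hε => ?_
  obtain ⟨δ, hδ, hf⟩ := hcont t x d ht htA hx hd ε hε
  exact ⟨δ, hδ, fun t' x' htt hlt hx' hxx => hf t' x' d (ht.trans htt) hx' hd
    (by rwa [abs_of_nonneg (by linarith)]) hxx (by simpa using hδ)⟩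

lemma StableSystem.rightCont_of_histNorm_eq_zero (S : StableSystem n l r D f σ L) (ht : 0 ≤ t)
    (hx : ContinuousOn x (Icc (-r) 0)) (hd : d ∈ D) (h : histNorm n r x = 0) :
    RightCont n l r f t x d := by
  intro ε hε
  obtain ⟨δ, hδ, hf⟩ := S.small ε hε t ht
  have h₀ : f t x d = 0 := by
    rw [S.regular.congr S.delay_nonneg ht hx hd (eqOn_zero_of_histNorm_eq_zero hx h)]
    exact S.zero t d ht hd
  refine ⟨δ / 2, half_pos hδ, fun t' x' htt hlt hx' hxx => ?_⟩
  have h₁ := histNorm_le_add S.delay_nonneg hx' hx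
  rw [h₀, sub_zero]
  refine hf t' x' d (ht.trans htt) hd hx' ?_
  rw [abs_of_nonneg (by linarith)]
  linarith

lemma rightCont_add_period_iff
    (hf : ∀ t x d, 0 ≤ t → ContinuousOn x (Icc (-r) 0) → d ∈ D → f (t + T) x d = f t x d)
    (ht : 0 ≤ t) (hx : ContinuousOn x (Icc (-r) 0)) (hd : d ∈ D) :
    RightCont n l r f (t + T) x d ↔ RightCont n l r f t x d := by
  constructor <;> intro h ε hε <;> obtain ⟨δ, hδ, hlt⟩ := h ε hε <;>
    refine ⟨δ, hδ, fun t' x' htt httδ hx' hxx => ?_⟩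
  · have := hlt (t' + T) x' (by linarith) (by linarith) hx' hxx
    rwa [hf t x d ht hx hd, hf t' x' d (ht.trans htt) hx' hd] at this
  · have := hlt (t' - T) x' (by linarith) (by linarith) hx' hxx
    rwa [← hf t x d ht hx hd, ← hf (t' - T) x' d (by linarith) hx' hd, sub_add_cancel] at this

lemma add_period_mem_irregularTimes_iff (hT : 0 ≤ T)
    (hf : ∀ t x d, 0 ≤ t → ContinuousOn x (Icc (-r) 0) → d ∈ D → f (t + T) x d = f t x d)
    (ht : 0 ≤ t) : t + T ∈ irregularTimes n l r D f ↔ t ∈ irregularTimes n l r D f := by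
  constructor
  · rintro ⟨-, x, d, hx, hd, h⟩
    exact ⟨ht, x, d, hx, hd, fun h' => h ((rightCont_add_period_iff hf ht hx hd).2 h')⟩
  · rintro ⟨-, x, d, hx, hd, h⟩
    exact ⟨by linarith, x, d, hx, hd,
      fun h' => h ((rightCont_add_period_iff hf ht hx hd).1 h')⟩

end Irregular

/-! ### The Lyapunov functional -/

/-- The Lyapunov functional: the gain functional, damped by a weight which forces a fast
decrease right after the times of irregularity. -/
def lyapunov (n l : ℕ) (r : ℝ) (D : Set (Euc l)) (f : ℝ → (ℝ → Euc n) → Euc l → Euc n)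
    (c : ℕ → ℝ) (t : ℝ) (x : ℝ → Euc n) : ℝ :=
  Real.exp (-dipWeight (irregularTimes n l r D f) t) * supGain n l r D f c t x

lemma Vdot_le_of_forall {n : ℕ} {r t b : ℝ} {V : ℝ → (ℝ → Euc n) → ℝ} {x : ℝ → Euc n}
    {v : Euc n} (H : ∀ ε > 0, ∃ δ > 0, ∀ h y, 0 < h → h < δ → ContinuousOn y (Icc (-r) 0) →
      histNorm n r y < δ → V (t + h) (fun θ => Eop n x h v θ + h • y θ) - V t x ≤ h * (b + ε)) :
    Vdot n r V t x v ≤ (b : EReal) := by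
  refine EReal.le_of_forall_lt_iff_le.1 fun z hz => ?_
  have hz' : b < z := by exact_mod_cast hz
  obtain ⟨δ, hδ, hV⟩ := H (z - b) (by linarith)
  refine iInf_le_of_le ⟨δ, hδ⟩ (iSup_le ?_)
  rintro ⟨⟨h, y⟩, hh, hhδ, hy, hyδ⟩
  refine EReal.coe_le_coe_iff.2 ?_
  rw [div_le_iff₀ hh]
  have := hV h y hh hhδ hy hyδ
  simp only
  linarith

section Lyapunov

variable {n l : ℕ} {r : ℝ} {D : Set (Euc l)} {f : ℝ → (ℝ → Euc n) → Euc l → Euc n}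
  {σ L : ℝ → ℝ → ℝ} {c M : ℕ → ℝ} {τ : ℕ → ℕ → ℝ} {t : ℝ} {x : ℝ → Euc n} {d : Euc l}

/-- Comparison of the gain functional along a linear extension with the gain functional along
a trajectory with frozen disturbance. -/
lemma StableSystem.exists_supGain_Eop_le (S : StableSystem n l r D f σ L)
    (W : GainWeights σ L c M τ) (ht : 0 ≤ t) (hx : ContinuousOn x (Icc (-r) 0))
    {φ : ℝ → Euc n} (hφ : IsTraj n l r D f t x (fun _ => d) φ) :
    ∃ Q, 0 ≤ Q ∧ ∃ δ₀ > 0, ∀ h K δ y, 0 < h → h < δ₀ → 0 ≤ K → K * h ≤ 1 → δ ≤ 1 →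
      (∀ s ∈ Ico t (t + h), ‖f s (fun θ => φ (s + θ)) d - f t x d‖ ≤ K) →
      ContinuousOn y (Icc (-r) 0) → histNorm n r y < δ →
      supGain n l r D f c (t + h) (fun θ => Eop n x h (f t x d) θ + h • y θ) ≤
        Real.exp (-(2 * h)) * supGain n l r D f c t x + Q * (K + δ) * h := by
  have hr := S.delay_nonneg
  obtain ⟨N, hN⟩ := exists_nat_ge t
  obtain ⟨P, hP⟩ := exists_nat_ge (t + histNorm n r x + 3)
  obtain ⟨δ₁, hδ₁, hclose⟩ := S.exists_histNorm_sub_lt N hx one_pos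
  have hx0 : 0 ≤ histNorm n r x := histNorm_nonneg _
  refine ⟨M P, W.nonneg P, min 1 δ₁, by positivity,
    fun h K δ y hh hhδ hK hKh hδ hvel hy hyδ => ?_⟩
  obtain ⟨hh1, hh2⟩ := lt_min_iff.1 hhδ
  set v := f t x d
  have hy0 : 0 ≤ histNorm n r y := histNorm_nonneg _
  have hzc : ContinuousOn (fun θ => Eop n x h v θ + h • y θ) (Icc (-r) 0) :=
    (continuousOn_Eop hh.le v hx).add (hy.const_smul h)
  have hφc := hφ.continuousOn_hist (t := t + h) (by linarith)
  have h₁ := hφ.histNorm_sub_Eop_le hr hh.le hvel hK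
  have h₂ : histNorm n r ((fun θ => Eop n x h v θ + h • y θ) - fun θ => φ (t + h + θ)) ≤
      (K + δ) * h := by
    refine histNorm_le hr fun θ hθ => ?_
    have h₃ := norm_le_histNorm (hφc.sub (continuousOn_Eop hh.le v hx)) hθ
    have h₄ := norm_le_histNorm hy hθ
    simp only [Pi.sub_apply] at h₃ ⊢
    have h₅ : Eop n x h v θ + h • y θ - φ (t + h + θ) =
        h • y θ - (φ (t + h + θ) - Eop n x h v θ) := by abel
    rw [h₅]
    refine (norm_sub_le _ _).trans ?_
    rw [norm_smul, Real.norm_of_nonneg hh.le]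
    have h₆ : h * ‖y θ‖ ≤ h * δ := by gcongr; linarith
    change ‖φ (t + h + θ) - Eop n x h v θ‖ ≤
      histNorm n r ((fun θ => φ (t + h + θ)) - Eop n x h v) at h₃
    linarith
  have h₃ := hclose t h _ φ ht hN hh.le hh2 hφ
  have h₄ := histNorm_le_add hr hφc hx
  have h₅ := histNorm_le_add hr hzc hφc
  have h₆ : δ * h ≤ 1 := by nlinarith
  have h₇ := S.supGain_le_add W (t₀ := t + h) (by linarith) hzc hφc (N := P) (by linarith)
    (by linarith) (by linarith)
  have h₈ := S.supGain_hist_le W ht hφ (t₁ := t + h) (by linarith)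
  rw [add_sub_cancel_left] at h₈
  have h₉ := mul_le_mul_of_nonneg_left h₂ (W.nonneg P)
  linarith

lemma StableSystem.supGain_pos (S : StableSystem n l r D f σ L) (W : GainWeights σ L c M τ)
    (ht : 0 ≤ t) (hx : ContinuousOn x (Icc (-r) 0)) (hpos : 0 < histNorm n r x) :
    0 < supGain n l r D f c t x := by
  obtain ⟨q, hq⟩ := exists_nat_one_div_lt hpos
  exact lt_of_lt_of_le (mul_pos (W.pos q) (lt_max_of_lt_right (by linarith)))
    (S.cutoff_le_supGain W ht hx q)

lemma exp_neg_le_quadratic {u : ℝ} (hu : 0 ≤ u) (hu1 : u ≤ 1) :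
    Real.exp (-u) ≤ 1 - u + u ^ 2 := by
  have := Real.abs_exp_sub_one_sub_id_le (x := -u) (by rwa [abs_neg, abs_of_nonneg hu])
  linarith [(abs_le.1 this).2, neg_sq u]

/-- Decrease of the Lyapunov functional where `f` is jointly right-continuous. -/
lemma StableSystem.Vdot_lyapunov_le_of_rightCont (S : StableSystem n l r D f σ L)
    (W : GainWeights σ L c M τ) (ht : 0 ≤ t) (hx : ContinuousOn x (Icc (-r) 0)) (hd : d ∈ D)
    (hreg : RightCont n l r f t x d) :
    Vdot n r (lyapunov n l r D f c) t x (f t x d) ≤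
      ((-(lyapunov n l r D f c t x) : ℝ) : EReal) := by
  obtain ⟨φ, hφ⟩ := S.exists_traj ht hx (MD.const hd)
  obtain ⟨Q, hQ, δ₀, hδ₀, hstep⟩ := S.exists_supGain_Eop_le W ht hx hφ
  have hG0 := S.supGain_nonneg W ht hx
  set w := dipWeight (irregularTimes n l r D f) with hw
  set G := supGain n l r D f c t x with hG
  set V := lyapunov n l r D f c t x with hV
  have hVeq : V = Real.exp (-w t) * G := rfl
  have hV0 : 0 ≤ V := by rw [hVeq]; positivity
  refine Vdot_le_of_forall fun ε hε => ?_
  set η := min (1 / 2) (ε / (12 * (Q + 1))) with hη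
  have hη0 : 0 < η := by positivity
  have hηε : 12 * Q * η ≤ ε := by
    have : η ≤ ε / (12 * (Q + 1)) := min_le_right _ _
    rw [le_div_iff₀ (by positivity)] at this
    nlinarith
  have hη1 : η ≤ 1 / 2 := min_le_left _ _
  obtain ⟨δ₁, hδ₁, hf⟩ := hreg η hη0
  obtain ⟨N, hN⟩ := exists_nat_ge t
  obtain ⟨δ₂, hδ₂, hclose⟩ := S.exists_histNorm_sub_lt N hx hδ₁
  refine ⟨min (min (min δ₀ δ₁) (min δ₂ η)) (ε / (2 * (V + 1))), by positivity,
    fun h y hh hhδ hy hyδ => ?_⟩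
  simp only [lt_min_iff] at hhδ hyδ
  obtain ⟨⟨⟨hh₀, hh₁⟩, hh₂, hhη⟩, hhε⟩ := hhδ
  have h₁ := hstep h η η y hh hh₀ hη0.le (by nlinarith) (by linarith) (fun s hs => by
    have hcl := hclose t (s - t) _ φ ht hN (by linarith [hs.1]) (by linarith [hs.2]) hφ
    rw [add_sub_cancel] at hcl
    exact (hf s _ hs.1 (by linarith [hs.2]) (hφ.continuousOn_hist hs.1) hcl).le) hy hyδ.1.2.2
  have h₂ : lyapunov n l r D f c (t + h) (fun θ => Eop n x h (f t x d) θ + h • y θ) ≤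
      Real.exp (-w t + h) * (Real.exp (-(2 * h)) * G + Q * (η + η) * h) := by
    refine mul_le_mul (Real.exp_le_exp.2 ?_) h₁ ?_ (Real.exp_pos _).le
    · linarith [dipWeight_sub_le (irregularTimes n l r D f) t hh.le]
    · exact S.supGain_nonneg W (by linarith)
        ((continuousOn_Eop hh.le _ hx).add (hy.const_smul h))
  have h₃ : Real.exp (-w t + h) * (Real.exp (-(2 * h)) * G + Q * (η + η) * h) =
      Real.exp (-h) * V + Real.exp (-w t) * Real.exp h * (Q * (η + η) * h) := by
    have h₄ : Real.exp (-h) = Real.exp h * Real.exp (-(2 * h)) := by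
      rw [← Real.exp_add]
      congr 1
      ring
    rw [hVeq, h₄, Real.exp_add]
    ring
  have h₄ : Real.exp (-w t) * Real.exp h ≤ 3 := by
    rw [← Real.exp_add]
    refine le_trans (Real.exp_le_exp.2 ?_) Real.exp_one_lt_three.le
    linarith [dipWeight_nonneg (irregularTimes n l r D f) t]
  have h₅ : Real.exp (-w t) * Real.exp h * (Q * (η + η) * h) ≤ 3 * (Q * (η + η) * h) :=
    mul_le_mul_of_nonneg_right h₄ (by positivity)
  have h₆ := mul_le_mul_of_nonneg_right (exp_neg_le_quadratic hh.le (by linarith)) hV0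
  rw [lt_div_iff₀ (by positivity)] at hhε
  have h₇ : h * (h * V) ≤ h * (ε / 2) := by
    refine mul_le_mul_of_nonneg_left ?_ hh.le
    nlinarith
  have h₈ : h * (12 * Q * η) ≤ h * ε := mul_le_mul_of_nonneg_left hηε hh.le
  nlinarith

/-- Decrease of the Lyapunov functional at times of irregularity. -/
lemma StableSystem.Vdot_lyapunov_le_of_not_rightCont (S : StableSystem n l r D f σ L)
    (W : GainWeights σ L c M τ) (ht : 0 ≤ t) (hx : ContinuousOn x (Icc (-r) 0)) (hd : d ∈ D)
    (hirr : ¬ RightCont n l r f t x d) :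
    Vdot n r (lyapunov n l r D f c) t x (f t x d) ≤
      ((-(lyapunov n l r D f c t x) : ℝ) : EReal) := by
  have hpos : 0 < histNorm n r x := (histNorm_nonneg x).lt_of_ne fun h =>
    hirr (S.rightCont_of_histNorm_eq_zero ht hx hd h.symm)
  have hmem : t ∈ irregularTimes n l r D f := ⟨ht, x, d, hx, hd, hirr⟩
  obtain ⟨φ, hφ⟩ := S.exists_traj ht hx (MD.const hd)
  obtain ⟨Q, hQ, δ₀, hδ₀, hstep⟩ := S.exists_supGain_Eop_le W ht hx hφ
  have hG0 := S.supGain_pos W ht hx hpos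
  obtain ⟨δ₁, hδ₁, hroot⟩ := exists_sqrt_le_dipWeight
    (fun C => S.regular.finite_irregularTimes C) ht
  obtain ⟨B, hB⟩ := S.bounded (t + 1) (σ (histNorm n r x) 0)
  set K := |B| + ‖f t x d‖ with hK
  have hK0 : 0 ≤ K := by positivity
  set G := supGain n l r D f c t x with hG
  have hV : lyapunov n l r D f c t x = G := by
    rw [lyapunov, dipWeight_eq_zero hmem, neg_zero, Real.exp_zero, one_mul]
  rw [hV]
  set R := Q * (K + 1) with hR
  have hR0 : 0 ≤ R := by positivity
  refine Vdot_le_of_forall fun ε hε => ?_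
  rw [hV]
  refine ⟨min (min (min δ₀ δ₁) (min 1 (1 / (K + 1)))) ((G / (2 * G + R)) ^ 2), by positivity,
    fun h y hh hhδ hy hyδ => ?_⟩
  simp only [lt_min_iff] at hhδ hyδ
  obtain ⟨⟨⟨hh₀, hh₁⟩, hh1, hhK⟩, hhG⟩ := hhδ
  rw [lt_div_iff₀ (by positivity)] at hhK
  have h₁ := hstep h K 1 y hh hh₀ hK0 (by nlinarith) le_rfl (fun s hs => by
    refine (norm_sub_le _ _).trans ?_
    have := hB s _ d (ht.trans hs.1) (by linarith [hs.2]) (hφ.continuousOn_hist hs.1)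
      (S.hist_le_zero ht hφ le_rfl hs.1) hd
    linarith [le_abs_self B]) hy hyδ.1.2.1
  set u := √h with hu
  have hu0 : 0 < u := Real.sqrt_pos.2 hh
  have huh : u ^ 2 = h := Real.sq_sqrt hh.le
  have hu1 : u ≤ 1 := Real.sqrt_le_one.2 hh1.le
  have huG : u * (2 * G + R) ≤ G := by
    rw [← le_div_iff₀ (by positivity)]
    exact Real.sqrt_le_iff.2 ⟨by positivity, hhG.le⟩
  have h₂ : lyapunov n l r D f c (t + h) (fun θ => Eop n x h (f t x d) θ + h • y θ) ≤
      (1 - u + u ^ 2) * (G + R * u ^ 2) := by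
    refine mul_le_mul ?_ (h₁.trans ?_) ?_ (by nlinarith)
    · refine le_trans (Real.exp_le_exp.2 ?_) (exp_neg_le_quadratic hu0.le hu1)
      linarith [hroot h hh.le hh₁ hmem]
    · have h₃ : Real.exp (-(2 * h)) * G ≤ G :=
        mul_le_of_le_one_left hG0.le (Real.exp_le_one_iff.2 (by linarith))
      rw [huh]
      linarith
    · exact S.supGain_nonneg W (by linarith)
        ((continuousOn_Eop hh.le _ hx).add (hy.const_smul h))
  have h₃ : (1 - u + u ^ 2) * (G + R * u ^ 2) ≤ (1 - u + u ^ 2) * G + R * u ^ 2 := by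
    have h₄ : 0 ≤ R * u ^ 2 := by positivity
    have h₅ : 1 - u + u ^ 2 ≤ 1 := by nlinarith
    nlinarith
  have h₄ : u * (u * (2 * G + R)) ≤ u * G := mul_le_mul_of_nonneg_left huG hu0.le
  have h₅ : 0 ≤ h * ε := by positivity
  have h₆ : u ^ 2 * G = h * G := by rw [huh]
  nlinarith

lemma StableSystem.lyapunov_le_supGain (S : StableSystem n l r D f σ L)
    (W : GainWeights σ L c M τ) (ht : 0 ≤ t) (hx : ContinuousOn x (Icc (-r) 0)) :
    lyapunov n l r D f c t x ≤ supGain n l r D f c t x :=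
  mul_le_of_le_one_left (S.supGain_nonneg W ht hx)
    (Real.exp_le_one_iff.2 (by linarith [dipWeight_nonneg (irregularTimes n l r D f) t]))

lemma StableSystem.abs_supGain_sub_le (S : StableSystem n l r D f σ L)
    (W : GainWeights σ L c M τ) (ht : 0 ≤ t) {y : ℝ → Euc n} (hx : ContinuousOn x (Icc (-r) 0))
    (hy : ContinuousOn y (Icc (-r) 0)) {N : ℕ} (htN : t ≤ N) (hxN : histNorm n r x ≤ N)
    (hyN : histNorm n r y ≤ N) :
    |supGain n l r D f c t y - supGain n l r D f c t x| ≤ M N * histNorm n r (y - x) := by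
  have h₁ := S.supGain_le_add W ht hx hy htN hxN hyN
  have h₂ := S.supGain_le_add W ht hy hx htN hyN hxN
  rw [histNorm_sub_comm] at h₁
  rw [abs_le]
  constructor <;> linarith

/-- Joint continuity of the gain functional. -/
lemma StableSystem.exists_abs_supGain_sub_lt_joint (S : StableSystem n l r D f σ L)
    (W : GainWeights σ L c M τ) (ht : 0 ≤ t) (hx : ContinuousOn x (Icc (-r) 0)) {ε : ℝ}
    (hε : 0 < ε) :
    ∃ δ > 0, ∀ t' x', 0 ≤ t' → ContinuousOn x' (Icc (-r) 0) →
      |t' - t| + histNorm n r (x' - x) < δ →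
      |supGain n l r D f c t' x' - supGain n l r D f c t x| < ε := by
  obtain ⟨N, hN⟩ := exists_nat_ge (t + histNorm n r x + 1)
  have hx0 : 0 ≤ histNorm n r x := histNorm_nonneg _
  have hM := W.nonneg N
  obtain ⟨δ, hδ, htime⟩ := S.exists_abs_supGain_sub_lt W hx N (half_pos hε)
  refine ⟨min (min 1 δ) (ε / (2 * (M N + 1))), by positivity, fun t' x' ht' hx' hlt => ?_⟩
  simp only [lt_min_iff] at hlt
  obtain ⟨⟨hlt1, hltδ⟩, hltε⟩ := hlt
  have ha := abs_nonneg (t' - t)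
  have hb : 0 ≤ histNorm n r (x' - x) := histNorm_nonneg _
  have hle := le_abs_self (t' - t)
  have h₁ := histNorm_le_add S.delay_nonneg hx' hx
  have h₂ := S.abs_supGain_sub_le W ht' hx hx' (N := N) (by linarith) (by linarith)
    (by linarith)
  have h₃ : M N * histNorm n r (x' - x) < ε / 2 := by
    rw [lt_div_iff₀ (by positivity)] at hltε
    nlinarith
  have h₄ : |supGain n l r D f c t' x - supGain n l r D f c t x| < ε / 2 := by
    rcases le_total t t' with h | h
    · have := htime t (t' - t) ht (by linarith) (by linarith) (by linarith)
      rwa [add_sub_cancel] at this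
    · have := htime t' (t - t') ht' (by linarith) (by linarith) (by
        linarith [neg_abs_le (t' - t)])
      rwa [add_sub_cancel, abs_sub_comm] at this
  calc |supGain n l r D f c t' x' - supGain n l r D f c t x|
      ≤ |supGain n l r D f c t' x' - supGain n l r D f c t' x| +
        |supGain n l r D f c t' x - supGain n l r D f c t x| := abs_sub_le _ _ _
    _ < ε := by linarith

lemma abs_exp_neg_sub_exp_neg_le {a b : ℝ} (ha : 0 ≤ a) (hb : 0 ≤ b) :
    |Real.exp (-a) - Real.exp (-b)| ≤ |a - b| := by
  have key : ∀ a b : ℝ, 0 ≤ a → a ≤ b → Real.exp (-a) - Real.exp (-b) ≤ b - a := by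
    intro a b ha hab
    have h₁ : Real.exp (-b) = Real.exp (-a) * Real.exp (-(b - a)) := by
      rw [← Real.exp_add]
      congr 1
      ring
    have h₂ := Real.add_one_le_exp (-(b - a))
    have h₃ : Real.exp (-a) ≤ 1 := Real.exp_le_one_iff.2 (by linarith)
    rw [h₁]
    nlinarith [Real.exp_pos (-a)]
  rcases le_total a b with h | h
  · rw [abs_of_nonneg (sub_nonneg.2 (Real.exp_le_exp.2 (by linarith))),
      abs_of_nonpos (by linarith)]
    linarith [key a b ha h]
  · rw [abs_sub_comm, abs_of_nonneg (sub_nonneg.2 (Real.exp_le_exp.2 (by linarith))),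
      abs_of_nonneg (by linarith)]
    exact key b a hb h

/-- The functional `lyapunov` has all the required properties. -/
theorem StableSystem.goodV_lyapunov (S : StableSystem n l r D f σ L)
    (W : GainWeights σ L c M τ) : GoodV n l r D f (lyapunov n l r D f c) := by
  set w := dipWeight (irregularTimes n l r D f) with hw
  have hw0 : ∀ t, 0 ≤ w t := dipWeight_nonneg _
  have hexp1 : ∀ t, Real.exp (-w t) ≤ 1 := fun t =>
    Real.exp_le_one_iff.2 (by linarith [hw0 t])
  refine ⟨fun t x ht hx ε hε => ?_, fun t x ht hx => ?_, ?_, fun t x d ht hx hd => ?_, ?_⟩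
  · obtain ⟨δ, hδ, hG⟩ := S.exists_abs_supGain_sub_lt_joint W ht hx (half_pos hε)
    have hG0 := S.supGain_nonneg W ht hx
    set G := supGain n l r D f c t x with hGdef
    have hlim : ∀ᶠ a in nhds (0 : ℝ), (√a + a) * G < ε / 2 := by
      have hc : ContinuousAt (fun a : ℝ => (√a + a) * G) 0 := by fun_prop
      refine hc.eventually_lt continuousAt_const ?_
      simpa using hε
    obtain ⟨δ', hδ', hlt⟩ := Metric.eventually_nhds_iff.1 hlim
    refine ⟨min δ δ', by positivity, fun t' x' ht' hx' hnear => ?_⟩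
    obtain ⟨h₁, h₂⟩ := lt_min_iff.1 hnear
    have h₃ := hG t' x' ht' hx' h₁
    have h₄ := hlt (y := |t' - t|) (by
      rw [Real.dist_eq, sub_zero, abs_abs]
      linarith [histNorm_nonneg (r := r) (x' - x)])
    have h₅ : |Real.exp (-w t') - Real.exp (-w t)| ≤ √|t' - t| + |t' - t| :=
      (abs_exp_neg_sub_exp_neg_le (hw0 t') (hw0 t)).trans (abs_dipWeight_sub_le _ t t')
    set G' := supGain n l r D f c t' x' with hG'
    have h₆ : lyapunov n l r D f c t' x' - lyapunov n l r D f c t x =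
        Real.exp (-w t') * (G' - G) + (Real.exp (-w t') - Real.exp (-w t)) * G := by
      simp only [lyapunov, ← hw, ← hGdef, ← hG']
      ring
    rw [h₆]
    refine (abs_add_le _ _).trans_lt ?_
    rw [abs_mul, abs_mul, abs_of_pos (Real.exp_pos _), abs_of_nonneg hG0]
    have h₇ := mul_le_mul_of_nonneg_right (hexp1 t') (abs_nonneg (G' - G))
    have h₈ := mul_le_mul_of_nonneg_right h₅ hG0
    linarith
  · exact mul_nonneg (Real.exp_pos _).le (S.supGain_nonneg W ht hx)
  · obtain ⟨a₁, ha₁, hlow⟩ := exists_isKInf_le_of_cutoff_le W.pos W.le_one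
    obtain ⟨a₂, ha₂, hup⟩ := exists_isKInf_majorant S.kl W.mono W.nonneg
    refine ⟨_, a₂, ha₁.const_mul (Real.exp_pos (-1)), ha₂, fun t x ht hx => ⟨?_, ?_⟩⟩
    · refine mul_le_mul (Real.exp_le_exp.2 ?_) (hlow _ _ (histNorm_nonneg _)
        fun q => S.cutoff_le_supGain W ht hx q) (ha₁.2.2.2.1 _ (histNorm_nonneg _))
        (Real.exp_pos _).le
      linarith [dipWeight_le_one (irregularTimes n l r D f) t]
    · exact (S.lyapunov_le_supGain W ht hx).trans
        ((S.supGain_le W ht hx (Nat.le_ceil _)).trans (hup _ (histNorm_nonneg _)))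
  · by_cases h : RightCont n l r f t x d
    · exact S.Vdot_lyapunov_le_of_rightCont W ht hx hd h
    · exact S.Vdot_lyapunov_le_of_not_rightCont W ht hx hd h
  · refine ⟨fun R => M ⌈R⌉₊, fun R _ => W.nonneg _,
      fun a _ b _ hab => W.mono (Nat.ceil_mono hab), fun R hR t x y ht hx hy hxR hyR => ?_⟩
    have hceil := Nat.le_ceil R
    have h₁ := S.abs_supGain_sub_le W ht.1 hx hy (ht.2.trans hceil) (hxR.trans hceil)
      (hyR.trans hceil)
    rw [lyapunov, lyapunov, ← mul_sub, abs_mul, abs_of_pos (Real.exp_pos _)]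
    exact (mul_le_of_le_one_left (abs_nonneg _) (hexp1 t)).trans h₁

/-- Beyond the first period, the functional `lyapunov` of a periodic system is periodic. -/
lemma lyapunov_add_period {T : ℝ} (hT : 0 ≤ T)
    (hf : ∀ t x d, 0 ≤ t → ContinuousOn x (Icc (-r) 0) → d ∈ D → f (t + T) x d = f t x d)
    (ht : 0 ≤ t) : lyapunov n l r D f c (t + T + T) x = lyapunov n l r D f c (t + T) x := by
  rw [lyapunov, lyapunov, supGain_add_period hT hf (add_nonneg ht hT),
    dipWeight_add_period hT (fun a ha => ha.1)
      (fun a ha => add_period_mem_irregularTimes_iff hT hf ha) ht]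

/-- For a periodic system, the required properties are invariant under a shift by a period. -/
lemma GoodV.shift {V : ℝ → (ℝ → Euc n) → ℝ} (hV : GoodV n l r D f V) {T : ℝ} (hT : 0 ≤ T)
    (hf : ∀ t x d, 0 ≤ t → ContinuousOn x (Icc (-r) 0) → d ∈ D → f (t + T) x d = f t x d) :
    GoodV n l r D f (fun t x => V (t + T) x) := by
  obtain ⟨hcont, hnonneg, ⟨a₁, a₂, ha₁, ha₂, hbound⟩, hdot, M, hM0, hMmono, hlip⟩ := hV
  refine ⟨fun t x ht hx ε hε => ?_, fun t x ht hx => hnonneg _ x (by linarith) hx,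
    ⟨a₁, a₂, ha₁, ha₂, fun t x ht hx => hbound _ x (by linarith) hx⟩,
    fun t x d ht hx hd => ?_, fun R => M (R + T), fun R hR => hM0 _ (by linarith),
    fun a ha b hb hab => hMmono (add_nonneg ha hT) (add_nonneg hb hT) (by linarith),
    fun R hR t x y ht hx hy hxR hyR => hlip (R + T) (by linarith) (t + T) x y
      ⟨by linarith [ht.1], by linarith [ht.2]⟩ hx hy (by linarith) (by linarith)⟩
  · obtain ⟨δ, hδ, h⟩ := hcont (t + T) x (by linarith) hx ε hε
    exact ⟨δ, hδ, fun t' x' ht' hx' hlt => h (t' + T) x' (by linarith) hx'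
      (by rwa [add_sub_add_right_eq_sub])⟩
  · have h := hdot (t + T) x d (by linarith) hx hd
    rw [hf t x d ht hx hd] at h
    simpa only [Vdot, add_right_comm t _ T] using h

end Lyapunov

/-- A function on `[0,∞)` which is eventually periodic for every period is constant on
`[1,∞)`. -/
lemma eq_one_of_forall_periodic {g : ℝ → ℝ}
    (hg : ∀ T t, 0 < T → 0 ≤ t → g (t + T + T) = g (t + T)) {a : ℝ} (ha : 1 ≤ a) :
    g a = g 1 := by
  have step : ∀ a b, a ≤ b → b ≤ 2 * a → g b = g a := by
    intro a b hab hb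
    rcases hab.eq_or_lt with rfl | h
    · rfl
    · have := hg (b - a) (2 * a - b) (by linarith) (by linarith)
      have e₁ : 2 * a - b + (b - a) = a := by ring
      rwa [e₁, add_sub_cancel] at this
  have main : ∀ k : ℕ, ∀ a : ℝ, 1 ≤ a → a ≤ 2 ^ k → g a = g 1 := by
    intro k
    induction k with
    | zero => intro a h₁ h₂; rw [le_antisymm (by simpa using h₂) h₁]
    | succ k ih =>
      intro a h₁ h₂
      rcases le_total a 2 with h | h
      · exact step 1 a h₁ (by linarith)
      · rw [step (a / 2) a (by linarith) (by linarith)]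
        exact ih _ (by linarith) (by rw [pow_succ] at h₂; linarith)
  obtain ⟨k, hk⟩ := pow_unbounded_of_one_lt a one_lt_two
  exact main k a ha hk.le

/-- **Theorem 2.10, (a) ⇒ (b), converse Lyapunov theorem with periodicity.**
Under hypotheses (H1)-(H4), if `0` is URGAS then there is a continuous Lyapunov functional
with uniform bounds, infinitesimal decrease and a local Lipschitz property; moreover if `f`
is `T`-periodic then `V` can be chosen `T`-periodic, and if `f` is time-invariant then `V`
can be chosen independent of `t`. -/
theorem stmt12 (n l : ℕ) (r : ℝ) (hr : 0 ≤ r) (D : Set (Euc l)) (hD : D.Nonempty)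
    (f : ℝ → (ℝ → Euc n) → Euc l → Euc n)
    (hf0 : ∀ t d, 0 ≤ t → d ∈ D → f t (fun _ => (0 : Euc n)) d = 0)
    (h1 : H1 n l r D f) (h2 : H2 n l r D f) (h3 : H3 n l r D f) (h4 : H4 n l r D f)
    (hurgas : URGAS n l r D f) :
    (∃ V : ℝ → (ℝ → Euc n) → ℝ, GoodV n l r D f V) ∧
    (∀ T : ℝ, 0 < T →
      (∀ t x d, 0 ≤ t → ContinuousOn x (Icc (-r) 0) → d ∈ D → f (t + T) x d = f t x d) →
      ∃ V : ℝ → (ℝ → Euc n) → ℝ, GoodV n l r D f V ∧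
        ∀ t x, 0 ≤ t → ContinuousOn x (Icc (-r) 0) → V (t + T) x = V t x) ∧
    ((∀ t s x d, 0 ≤ t → 0 ≤ s → ContinuousOn x (Icc (-r) 0) → d ∈ D →
        f t x d = f s x d) →
      ∃ V : ℝ → (ℝ → Euc n) → ℝ, GoodV n l r D f V ∧
        ∀ t s x, 0 ≤ t → 0 ≤ s → ContinuousOn x (Icc (-r) 0) → V t x = V s x) := by
  obtain ⟨L, -, hLr, hLl, hL0, hone⟩ := h1
  obtain ⟨σ, hσ, hex, hest⟩ := hurgas
  have S : StableSystem n l r D f σ L :=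
    ⟨hr, hD, hf0, hLr, hLl, hL0, hone, h2, h3, h4, hσ, hex, hest⟩
  obtain ⟨c, M, τ, W⟩ := exists_gainWeights hσ hLr hLl hL0
  have hV := S.goodV_lyapunov W
  refine ⟨⟨_, hV⟩, fun T hT hf => ⟨_, hV.shift hT.le hf,
    fun t x ht _ => lyapunov_add_period hT.le hf ht⟩, fun hf => ?_⟩
  have hper : ∀ T, 0 ≤ T → ∀ t x d, 0 ≤ t → ContinuousOn x (Icc (-r) 0) → d ∈ D →
      f (t + T) x d = f t x d :=
    fun T hT t x d ht hx hd => hf (t + T) t x d (by linarith) ht hx hd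
  refine ⟨_, hV.shift zero_le_one (hper 1 zero_le_one), fun t s x ht hs _ => ?_⟩
  have hconst : ∀ a, 1 ≤ a → lyapunov n l r D f c a x = lyapunov n l r D f c 1 x :=
    fun a ha => eq_one_of_forall_periodic (g := fun u => lyapunov n l r D f c u x)
      (fun T t hT ht => lyapunov_add_period hT.le (hper T hT.le) ht) ha
  exact (hconst (t + 1) (by linarith)).trans (hconst (s + 1) (by linarith)).symm

end
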